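/- arXiv:1610.02704 — 3 statements merged into one kernel-verified Lean document; each statement's English description precedes it below -/
import Mathlib

section
/- For every n ≥ 1, every f : {-1,1}^n → ℝ≥0, and every integer b ≥ 1, the nonnegative rank of the pattern matrix satisfies nnr(M_f^b) ≤ binomial(n, deg₊(f)) · 2^{b·deg₊(f)}. -/
open scoped BigOperators

noncomputable section

/-- Sign of a Boolean bit, encoding `b ↦ (-1)^b ∈ {-1,1}`. -/
def sgn (x : Bool) : ℝ := if x then -1 else 1

/-- Expectation under the uniform distribution on a finite type. -/
def uexp {Ω : Type*} [Fintype Ω] (f : Ω → ℝ) : ℝ :=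
  (∑ x, f x) / (Fintype.card Ω : ℝ)

/-- The parity character `χ_S(x) = ∏_{i ∈ S} x_i` on the cube `{-1,1}^n`. -/
def chi {n : ℕ} (S : Finset (Fin n)) (x : Fin n → Bool) : ℝ :=
  ∏ i ∈ S, sgn (x i)

/-- Fourier coefficient `f̂(S) = E[f · χ_S]`. -/
def fCoeff {n : ℕ} (f : (Fin n → Bool) → ℝ) (S : Finset (Fin n)) : ℝ :=
  uexp (fun x => f x * chi S x)

open Classical in
/-- Fourier degree: the largest `|S|` with `f̂(S) ≠ 0`. -/
def fdeg {n : ℕ} (f : (Fin n → Bool) → ℝ) : ℕ :=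
  (Finset.univ.filter (fun S : Finset (Fin n) => fCoeff f S ≠ 0)).sup Finset.card

/-- A `d`-junta: a function depending on at most `d` coordinates. -/
def IsJunta {n : ℕ} (d : ℕ) (h : (Fin n → Bool) → ℝ) : Prop :=
  ∃ T : Finset (Fin n), T.card ≤ d ∧ ∀ x y, (∀ i ∈ T, x i = y i) → h x = h y

/-- A conical `d`-junta: a nonnegative combination of nonnegative `d`-juntas. -/
def IsConicalJunta {n : ℕ} (d : ℕ) (f : (Fin n → Bool) → ℝ) : Prop :=
  ∃ (N : ℕ) (c : Fin N → ℝ) (g : Fin N → (Fin n → Bool) → ℝ),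
    (∀ i, 0 ≤ c i) ∧ (∀ i x, 0 ≤ g i x) ∧ (∀ i, IsJunta d (g i)) ∧
    ∀ x, f x = ∑ i, c i * g i x

/-- Nonnegative degree `deg₊(f)`: least `d` such that `f` is a conical `d`-junta. -/
def degPlus {n : ℕ} (f : (Fin n → Bool) → ℝ) : ℕ :=
  sInf {d | IsConicalJunta d f}

/-- The (modified inner-product) gadget `g : {0,1}^b × {0,1}^b → {-1,1}`,
with output encoded as a Boolean exponent: `g(x,y) = x₁ ⊕ y₁ ⊕ (⊕ᵢ xᵢyᵢ)`. -/
def gadget {b : ℕ} (x y : Fin b → Bool) : Bool :=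
  decide (((∑ i : Fin b,
        (if x i then (1 : ZMod 2) else 0) * (if y i then (1 : ZMod 2) else 0))
    + (if h : 0 < b then
        (if x ⟨0, h⟩ then (1 : ZMod 2) else 0) + (if y ⟨0, h⟩ then (1 : ZMod 2) else 0)
      else 0)) = 1)

/-- `G = g^{⊗n}`, the gadget applied coordinatewise. -/
def gadgetN {n b : ℕ} (x y : Fin n → Fin b → Bool) : Fin n → Bool :=
  fun i => gadget (x i) (y i)

/-- The pattern matrix `M_f^b(x,y) = f(g^{⊗n}(x,y))`. -/
def patternMatrix {n : ℕ} (b : ℕ) (f : (Fin n → Bool) → ℝ) :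
    (Fin n → Fin b → Bool) → (Fin n → Fin b → Bool) → ℝ :=
  fun x y => f (gadgetN x y)

/-- Nonnegative rank: least `r` such that `M` is a sum of `r` nonnegative rank-1 matrices. -/
def nnRank {α β : Type*} [Fintype α] [Fintype β] (M : α → β → ℝ) : ℕ :=
  sInf {r | ∃ (u : Fin r → α → ℝ) (v : Fin r → β → ℝ),
    (∀ i a, 0 ≤ u i a) ∧ (∀ i b, 0 ≤ v i b) ∧ ∀ a b, M a b = ∑ i, u i a * v i b}

/-- Entrywise sup-norm of a matrix. -/
def supAbs {α β : Type*} [Fintype α] [Fintype β] (M : α → β → ℝ) : ℝ :=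
  ⨆ p : α × β, |M p.1 p.2|

/-- `ε`-approximate nonnegative rank. -/
def approxNNRank {α β : Type*} [Fintype α] [Fintype β] (ε : ℝ) (M : α → β → ℝ) : ℕ :=
  sInf {r | ∃ M' : α → β → ℝ, (∀ a b, 0 ≤ M' a b) ∧
    (∀ a b, |M' a b - M a b| ≤ ε * supAbs M) ∧ nnRank M' ≤ r}

/-- A density: nonnegative with expectation 1 under the uniform distribution. -/
def IsDensity {Ω : Type*} [Fintype Ω] (u : Ω → ℝ) : Prop :=
  (∀ x, 0 ≤ u x) ∧ uexp u = 1

/-- `Pr_{X ~ μ}[X ∈ S]` for a density `μ`. -/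
def prSet {Ω : Type*} [Fintype Ω] (μ : Ω → ℝ) (S : Finset Ω) : ℝ :=
  (∑ x ∈ S, μ x) / (Fintype.card Ω : ℝ)

/-- Min-entropy `H∞(u) = min_x log₂(|Ω| / u(x)) = -log₂ max_x Pr[X = x]`. -/
def minEntropy {Ω : Type*} [Fintype Ω] (u : Ω → ℝ) : ℝ :=
  - Real.logb 2 (⨆ x, u x / (Fintype.card Ω : ℝ))

open Classical in
/-- `Pr_{X ~ u}[X_I = y_I]`, the probability that the projection to `I` agrees with `y`. -/
def prMarg {n : ℕ} {α : Type*} [Fintype α] (u : (Fin n → α) → ℝ) (I : Finset (Fin n))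
    (y : Fin n → α) : ℝ :=
  (∑ x ∈ Finset.univ.filter (fun x : Fin n → α => ∀ i ∈ I, x i = y i), u x)
    / (Fintype.card (Fin n → α) : ℝ)

/-- Min-entropy of the projection `X_I` for `X ~ u`. -/
def projMinEntropy {n : ℕ} {α : Type*} [Fintype α] (u : (Fin n → α) → ℝ)
    (I : Finset (Fin n)) : ℝ :=
  - Real.logb 2 (⨆ y : Fin n → α, prMarg u I y)

/-- Blockwise-dense: every projection has min-entropy at least `0.8 |I| log₂ q`. -/
def IsBlockwiseDense {n : ℕ} {α : Type*} [Fintype α] (u : (Fin n → α) → ℝ) : Prop :=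
  ∀ I : Finset (Fin n),
    0.8 * (I.card : ℝ) * Real.logb 2 (Fintype.card α) ≤ projMinEntropy u I

/-- `d`-CBD with fixed set `I`: `X_I` is fixed and every disjoint projection is dense. -/
def IsCBDWith {n : ℕ} {α : Type*} [Fintype α] (d : ℝ) (I : Finset (Fin n))
    (u : (Fin n → α) → ℝ) : Prop :=
  (I.card : ℝ) ≤ d ∧ projMinEntropy u I = 0 ∧
  ∀ J : Finset (Fin n), Disjoint J I →
    0.8 * (J.card : ℝ) * Real.logb 2 (Fintype.card α) ≤ projMinEntropy u J

/-- `d`-CBD distribution. -/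
def IsCBD {n : ℕ} {α : Type*} [Fintype α] (d : ℝ) (u : (Fin n → α) → ℝ) : Prop :=
  ∃ I, IsCBDWith d I u

open Classical in
/-- `Acc_{u,v}`: the density on `{-1,1}^n` of `g^{⊗n}(X,Y)` for independent `X ~ u`, `Y ~ v`. -/
def AccFn {n b : ℕ} (u v : (Fin n → Fin b → Bool) → ℝ) (z : Fin n → Bool) : ℝ :=
  (2 : ℝ) ^ n * (∑ x : Fin n → Fin b → Bool, ∑ y : Fin n → Fin b → Bool,
      if gadgetN x y = z then u x * v y else 0)
    / (Fintype.card (Fin n → Fin b → Bool) : ℝ) ^ 2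

/-- `ε`-decaying function: mean zero with `|ĥ(S)| ≤ ε^{|S|}`. -/
def IsDecaying {n : ℕ} (ε : ℝ) (h : (Fin n → Bool) → ℝ) : Prop :=
  uexp h = 0 ∧ ∀ S : Finset (Fin n), |fCoeff h S| ≤ ε ^ S.card

/-- A `d`-conjunction, normalized to have expectation 1. -/
def IsConjunction {n : ℕ} (d : ℕ) (C : (Fin n → Bool) → ℝ) : Prop :=
  ∃ (I : Finset (Fin n)) (a : Fin n → Bool), I.card ≤ d ∧
    ∀ x, C x = 2 ^ I.card * (if ∀ i ∈ I, x i = a i then (1 : ℝ) else 0)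

/-- `(ε,δ)`-approximate conical `d`-junta. -/
def IsApproxConicalJunta {n : ℕ} (ε δ : ℝ) (d : ℕ) (f : (Fin n → Bool) → ℝ) : Prop :=
  ∃ (N : ℕ) (lam : Fin N → ℝ) (C h : Fin N → (Fin n → Bool) → ℝ)
    (γ : (Fin n → Bool) → ℝ),
    (∀ i, 0 ≤ lam i) ∧ (∑ i, lam i) ≤ 1 ∧
    (∀ i, IsConjunction d (C i)) ∧ (∀ i, IsDecaying ε (h i)) ∧
    (∀ x, 0 ≤ γ x) ∧ uexp γ ≤ δ ∧
    ∀ x, f x = (∑ i, lam i * C i x * (1 + h i x)) + γ x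

open Classical in
/-- The density `μ` conditioned on the event `S`. -/
def condDensity {Ω : Type*} [Fintype Ω] (μ : Ω → ℝ) (S : Finset Ω) : Ω → ℝ :=
  fun x => if x ∈ S then μ x / prSet μ S else 0

/-- First marginal density of a density on a product. -/
def margFst {Ω : Type*} [Fintype Ω] (μ : Ω × Ω → ℝ) : Ω → ℝ :=
  fun x => (∑ y, μ (x, y)) / (Fintype.card Ω : ℝ)

/-- Second marginal density of a density on a product. -/
def margSnd {Ω : Type*} [Fintype Ω] (μ : Ω × Ω → ℝ) : Ω → ℝ :=
  fun y => (∑ x, μ (x, y)) / (Fintype.card Ω : ℝ)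

open Classical in
/-- `Pr_{(X,Y) ~ μ}[X_I = y.1_I ∧ Y_I = y.2_I]`. -/
def prMarg2 {n : ℕ} {α : Type*} [Fintype α]
    (μ : (Fin n → α) × (Fin n → α) → ℝ) (I : Finset (Fin n))
    (y : (Fin n → α) × (Fin n → α)) : ℝ :=
  (∑ x ∈ Finset.univ.filter
      (fun x : (Fin n → α) × (Fin n → α) =>
        (∀ i ∈ I, x.1 i = y.1 i) ∧ (∀ i ∈ I, x.2 i = y.2 i)), μ x)
    / (Fintype.card ((Fin n → α) × (Fin n → α)) : ℝ)

/-- Min-entropy of the projection `μ_I` of a density on a product, projecting both factors. -/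
def projMinEntropy2 {n : ℕ} {α : Type*} [Fintype α]
    (μ : (Fin n → α) × (Fin n → α) → ℝ) (I : Finset (Fin n)) : ℝ :=
  - Real.logb 2 (⨆ y : (Fin n → α) × (Fin n → α), prMarg2 μ I y)

/-- Transfer of a nonnegative factorization over a finite index type to a bound on `nnRank`. -/
theorem nnRank_le_card {α β ι : Type*} [Fintype α] [Fintype β] [Fintype ι] (M : α → β → ℝ)
    (u : ι → α → ℝ) (v : ι → β → ℝ) (hu : ∀ i a, 0 ≤ u i a) (hv : ∀ i b, 0 ≤ v i b)
    (h : ∀ a b, M a b = ∑ i, u i a * v i b) : nnRank M ≤ Fintype.card ι := by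
  refine Nat.sInf_le ⟨fun k => u ((Fintype.equivFin ι).symm k),
    fun k => v ((Fintype.equivFin ι).symm k), fun _ _ => hu _ _, fun _ _ => hv _ _, ?_⟩
  intro a b
  rw [h]
  exact (Equiv.sum_comp (Fintype.equivFin ι).symm (fun i => u i a * v i b)).symm

theorem isConicalJunta_full {n : ℕ} (f : (Fin n → Bool) → ℝ) (hf : ∀ x, 0 ≤ f x) :
    IsConicalJunta n f := by
  refine ⟨1, fun _ => 1, fun _ => f, fun _ => zero_le_one, fun _ => hf, fun _ => ?_, ?_⟩
  · refine ⟨Finset.univ, by simp, fun x y h => ?_⟩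
    rw [show x = y from funext fun i => h i (Finset.mem_univ i)]
  · intro x; simp

/-- Extend a partial assignment on `S` by a default value. -/
def extendBlock {n b : ℕ} (S : Finset (Fin n)) (z : S → Fin b → Bool) : Fin n → Fin b → Bool :=
  fun i => if h : i ∈ S then z ⟨i, h⟩ else fun _ => false

/-- the easy upper bound on the nonnegative rank of a pattern matrix. -/
theorem stmt1 (n : ℕ) (hn : 1 ≤ n) (f : (Fin n → Bool) → ℝ) (hf : ∀ x, 0 ≤ f x)
    (b : ℕ) (hb : 1 ≤ b) :
    nnRank (patternMatrix b f) ≤ n.choose (degPlus f) * 2 ^ (b * degPlus f) := by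
  classical
  have hd : degPlus f ≤ n := Nat.sInf_le (isConicalJunta_full f hf)
  have hc : IsConicalJunta (degPlus f) f :=
    Nat.sInf_mem (s := {d | IsConicalJunta d f}) ⟨n, isConicalJunta_full f hf⟩
  generalize degPlus f = d at hd hc ⊢
  obtain ⟨N, c, g, hc0, hg0, hj, hfe⟩ := hc
  have hT : ∀ k, ∃ T : {S : Finset (Fin n) // S.card = d},
      ∀ x y, (∀ i ∈ T.1, x i = y i) → g k x = g k y := by
    intro k
    obtain ⟨T, hTc, hTe⟩ := hj k
    obtain ⟨S, hTS, hS⟩ := Finset.exists_superset_card_eq hTc (by simpa using hd)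
    exact ⟨⟨S, hS⟩, fun x y h => hTe x y fun i hi => h i (hTS hi)⟩
  choose T hTe using hT
  have key := nnRank_le_card (ι := Σ S : {S : Finset (Fin n) // S.card = d}, (S.1 → Fin b → Bool))
    (patternMatrix b f)
    (fun p x => if (fun i : p.1.1 => x i.1) = p.2 then 1 else 0)
    (fun p y => ∑ k, if T k = p.1 then c k * g k (gadgetN (extendBlock p.1.1 p.2) y) else 0)
    (fun p x => by split_ifs <;> norm_num)
    (fun p y => Finset.sum_nonneg fun k _ => by
      split_ifs
      · exact mul_nonneg (hc0 k) (hg0 k _)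
      · exact le_rfl)
    (fun x y => by
      rw [Fintype.sum_sigma]
      simp only [ite_mul, one_mul, zero_mul, Finset.sum_ite_eq, Finset.mem_univ, if_true]
      rw [Finset.sum_comm]
      simp only [Finset.sum_ite_eq, Finset.mem_univ, if_true]
      simp only [patternMatrix, hfe]
      refine Finset.sum_congr rfl fun k _ => ?_
      congr 1
      apply hTe k
      intro i hi
      simp [gadgetN, extendBlock, hi])
  refine key.trans (le_of_eq ?_)
  rw [Fintype.card_sigma]
  have : ∀ S : {S : Finset (Fin n) // S.card = d},
      Fintype.card (S.1 → Fin b → Bool) = 2 ^ (b * d) := by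
    intro S
    simp [S.2, pow_mul]
  rw [Finset.sum_congr rfl fun S _ => this S]
  simp
end
end

section
/- There exists a constant α₁ ≥ 1 such that the following holds. For every n ≥ 1, every integer b ≥ α₁·log₂ n, and every f : {-1,1}^n → ℝ≥0 with E[f] = 1, the function f is a (2^{-b/2}, 2^{-b·d/α₁})-approximate conical d-junta for every integer d ≥ α₁·log₂(nnr(M_f^b))/b. -/
open scoped BigOperators

noncomputable section

/-! ## Conjunctions and the cone they generate -/

lemma sgn_mul_self (a : Bool) : sgn a * sgn a = 1 := by
  cases a <;> simp [sgn]

lemma sgn_abs (a : Bool) : |sgn a| = 1 := by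
  cases a <;> simp [sgn]

lemma one_add_sgn (a b : Bool) : 1 + sgn a * sgn b = if a = b then 2 else 0 := by
  cases a <;> cases b <;> norm_num [sgn]

lemma one_add_sgn_nonneg (a b : Bool) : 0 ≤ 1 + sgn a * sgn b := by
  rw [one_add_sgn]; split_ifs <;> norm_num

lemma sum_bool_one_add (a : Bool) : ∑ c : Bool, (1 + sgn c * sgn a) = 2 := by
  cases a <;> norm_num [sgn]

/-- The normalized conjunction in product form. -/
def conj {n : ℕ} (I : Finset (Fin n)) (a z : Fin n → Bool) : ℝ :=
  ∏ i ∈ I, (1 + sgn (z i) * sgn (a i))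

lemma conj_nonneg {n : ℕ} (I : Finset (Fin n)) (a z : Fin n → Bool) : 0 ≤ conj I a z :=
  Finset.prod_nonneg fun _ _ => one_add_sgn_nonneg _ _

lemma conj_eq {n : ℕ} (I : Finset (Fin n)) (a z : Fin n → Bool) :
    conj I a z = 2 ^ I.card * (if ∀ i ∈ I, z i = a i then (1 : ℝ) else 0) := by
  unfold conj
  simp_rw [one_add_sgn]
  split_ifs with h
  · rw [Finset.prod_congr rfl (g := fun _ => (2 : ℝ)) (fun i hi => by simp [h i hi])]
    simp
  · push Not at h
    obtain ⟨i, hi, hne⟩ := h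
    rw [Finset.prod_eq_zero hi (by simp [hne])]
    simp

lemma conj_comm {n : ℕ} (I : Finset (Fin n)) (a z : Fin n → Bool) : conj I a z = conj I z a := by
  unfold conj
  exact Finset.prod_congr rfl fun i _ => by ring

lemma sum_prod_one_add {n : ℕ} (a : Fin n → Bool) :
    ∑ z : Fin n → Bool, ∏ i, (1 + sgn (z i) * sgn (a i)) = 2 ^ n := by
  have := Fintype.prod_sum (fun (i : Fin n) (c : Bool) => (1 + sgn c * sgn (a i)))
  rw [← this]
  simp only [sum_bool_one_add]
  simp

lemma sum_conj {n : ℕ} (I : Finset (Fin n)) (a : Fin n → Bool) :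
    ∑ z, conj I a z = 2 ^ n := by
  have h1 : ∀ z, conj I a z = ∏ i, (if i ∈ I then (1 + sgn (z i) * sgn (a i)) else 1) := by
    intro z
    unfold conj
    rw [Finset.prod_ite_mem]
    simp
  simp_rw [h1]
  have := Fintype.prod_sum (fun (i : Fin n) (c : Bool) =>
    (if i ∈ I then (1 + sgn c * sgn (a i)) else 1))
  rw [← this]
  have h2 : ∀ i, ∑ c : Bool, (if i ∈ I then (1 + sgn c * sgn (a i)) else 1) = 2 := by
    intro i
    by_cases h : i ∈ I
    · simp only [h, if_true]; exact sum_bool_one_add _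
    · simp [h]
  simp_rw [h2]
  simp

lemma uexp_conj {n : ℕ} (I : Finset (Fin n)) (a : Fin n → Bool) :
    uexp (conj I a) = 1 := by
  unfold uexp
  rw [sum_conj]
  simp

/-- Index set of the `d`-conjunctions. -/
abbrev CIdx (n d : ℕ) := {p : Finset (Fin n) × (Fin n → Bool) // p.1.card ≤ d}

/-- Nonnegative combinations of `d`-conjunctions. -/
def InCone {n : ℕ} (d : ℕ) (F : (Fin n → Bool) → ℝ) : Prop :=
  ∃ lam : CIdx n d → ℝ, (∀ p, 0 ≤ lam p) ∧ ∀ z, F z = ∑ p, lam p * conj p.1.1 p.1.2 z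

lemma InCone.zero {n d : ℕ} : InCone d (fun _ : Fin n → Bool => (0 : ℝ)) :=
  ⟨fun _ => 0, fun _ => le_rfl, fun z => by simp⟩

lemma InCone.add {n d : ℕ} {F G : (Fin n → Bool) → ℝ} (hF : InCone d F) (hG : InCone d G) :
    InCone d (fun z => F z + G z) := by
  obtain ⟨l, hl, h⟩ := hF
  obtain ⟨l', hl', h'⟩ := hG
  refine ⟨fun p => l p + l' p, fun p => add_nonneg (hl p) (hl' p), fun z => ?_⟩
  beta_reduce
  rw [h, h', ← Finset.sum_add_distrib]
  exact Finset.sum_congr rfl fun p _ => by ring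

lemma InCone.sum {n d : ℕ} {ι : Type*} (s : Finset ι) (F : ι → (Fin n → Bool) → ℝ)
    (hF : ∀ i ∈ s, InCone d (F i)) : InCone d (fun z => ∑ i ∈ s, F i z) := by
  classical
  induction s using Finset.induction_on with
  | empty => simpa using InCone.zero
  | insert a s ha ih =>
    simp_rw [Finset.sum_insert ha]
    exact (hF a (by simp)).add (ih fun i hi => hF i (by simp [hi]))

/-- A nonnegative junta lies in the cone. -/
lemma InCone.of_junta {n d : ℕ} (T : Finset (Fin n)) (hT : T.card ≤ d)
    (F : (Fin n → Bool) → ℝ) (hF : ∀ z, 0 ≤ F z)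
    (hJ : ∀ z z', (∀ i ∈ T, z i = z' i) → F z = F z') : InCone d F := by
  have key : InCone d (fun z => ∑ a : Fin n → Bool, F a * (2 ^ n)⁻¹ * conj T a z) := by
    apply InCone.sum
    intro a _
    refine ⟨fun p => if p = ⟨(T, a), hT⟩ then F a * (2 ^ n)⁻¹ else 0, ?_, ?_⟩
    · intro p
      beta_reduce
      split_ifs
      · exact mul_nonneg (hF a) (by positivity)
      · exact le_rfl
    · intro z
      simp [ite_mul]
  convert key using 2 with z
  have : ∀ a, F a * (2 ^ n)⁻¹ * conj T a z = F z * (2 ^ n)⁻¹ * conj T z a := by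
    intro a
    rw [conj_comm T z a]
    rw [conj_eq]
    split_ifs with h
    · rw [hJ z a h]
    · simp
  simp_rw [this, ← Finset.mul_sum, sum_conj]
  field_simp

/-- A function that is a conical junta up to a nonnegative error of mean at most `e`. -/
def Good {n : ℕ} (d : ℕ) (F : (Fin n → Bool) → ℝ) (e : ℝ) : Prop :=
  ∃ A γ : (Fin n → Bool) → ℝ, InCone d A ∧ (∀ z, 0 ≤ γ z) ∧ uexp γ ≤ e ∧ ∀ z, F z = A z + γ z

lemma uexp_add {Ω : Type*} [Fintype Ω] (f g : Ω → ℝ) :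
    uexp (fun x => f x + g x) = uexp f + uexp g := by
  unfold uexp
  rw [Finset.sum_add_distrib, add_div]

lemma uexp_mono {Ω : Type*} [Fintype Ω] {f g : Ω → ℝ} (h : ∀ x, f x ≤ g x) :
    uexp f ≤ uexp g := by
  unfold uexp
  gcongr
  exact h _

lemma uexp_mul_right {Ω : Type*} [Fintype Ω] (f : Ω → ℝ) (c : ℝ) :
    uexp (fun x => f x * c) = uexp f * c := by
  unfold uexp
  rw [← Finset.sum_mul]
  ring

lemma Good.mono {n d : ℕ} {F : (Fin n → Bool) → ℝ} {e e' : ℝ} (h : Good d F e) (hee : e ≤ e') :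
    Good d F e' := by
  obtain ⟨A, γ, h1, h2, h3, h4⟩ := h
  exact ⟨A, γ, h1, h2, h3.trans hee, h4⟩

lemma Good.add {n d : ℕ} {F G : (Fin n → Bool) → ℝ} {e e' : ℝ} (hF : Good d F e)
    (hG : Good d G e') : Good d (fun z => F z + G z) (e + e') := by
  obtain ⟨A, γ, h1, h2, h3, h4⟩ := hF
  obtain ⟨B, κ, g1, g2, g3, g4⟩ := hG
  refine ⟨fun z => A z + B z, fun z => γ z + κ z, h1.add g1, fun z => add_nonneg (h2 z) (g2 z),
    ?_, fun z => ?_⟩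
  · rw [uexp_add]; linarith
  · beta_reduce
    rw [h4, g4]; ring

lemma Good.error {n d : ℕ} {F : (Fin n → Bool) → ℝ} (hF : ∀ z, 0 ≤ F z) : Good d F (uexp F) :=
  ⟨fun _ => 0, F, InCone.zero, hF, le_rfl, fun z => by simp⟩

lemma Good.sum {n d : ℕ} {ι : Type*} (s : Finset ι) (F : ι → (Fin n → Bool) → ℝ) (e : ι → ℝ)
    (hF : ∀ i ∈ s, Good d (F i) (e i)) : Good d (fun z => ∑ i ∈ s, F i z) (∑ i ∈ s, e i) := by
  classical
  induction s using Finset.induction_on with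
  | empty =>
    refine ⟨fun _ => 0, fun _ => 0, InCone.zero, fun _ => le_rfl, ?_, fun z => by simp⟩
    simp [uexp]
  | insert a s ha ih =>
    simp_rw [Finset.sum_insert ha]
    exact (hF a (by simp)).add (ih fun i hi => hF i (by simp [hi]))

/-- A `Good` density is an approximate conical junta. -/
lemma Good.approx {n d : ℕ} {F : (Fin n → Bool) → ℝ} {e ε : ℝ} (hε : 0 ≤ ε) (h : Good d F e)
    (hF : uexp F = 1) : IsApproxConicalJunta ε e d F := by
  obtain ⟨A, γ, ⟨l, hl, hA⟩, h2, h3, h4⟩ := h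
  let E := Fintype.equivFin (CIdx n d)
  have hsum : ∀ z, F z = (∑ i, l (E.symm i) * conj (E.symm i).1.1 (E.symm i).1.2 z) + γ z := by
    intro z
    rw [h4, hA, E.symm.sum_comp (fun p => l p * conj p.1.1 p.1.2 z)]
  refine ⟨Fintype.card (CIdx n d), fun i => l (E.symm i),
    fun i => conj (E.symm i).1.1 (E.symm i).1.2, fun _ _ => 0, γ, fun i => hl _, ?_, ?_, ?_,
    h2, h3, ?_⟩
  · have h5 : uexp F = (∑ i, l (E.symm i)) + uexp γ := by
      have : F = fun z => (∑ i, l (E.symm i) * conj (E.symm i).1.1 (E.symm i).1.2 z) + γ z :=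
        funext hsum
      rw [this, uexp_add]
      congr 1
      unfold uexp
      rw [Finset.sum_comm]
      simp_rw [← Finset.mul_sum, sum_conj]
      rw [← Finset.sum_mul]
      simp
    have h6 : 0 ≤ uexp γ := by
      unfold uexp
      exact div_nonneg (Finset.sum_nonneg fun z _ => h2 z) (by positivity)
    linarith
  · intro i
    exact ⟨_, _, (E.symm i).2, fun z => conj_eq _ _ _⟩
  · intro i
    refine ⟨by simp [uexp], fun S => ?_⟩
    simp only [fCoeff, uexp, zero_mul, Finset.sum_const_zero, zero_div, abs_zero]
    positivity
  · intro z
    rw [hsum]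
    simp

section Rect

/-! ## Acceptance functions of rectangles -/

set_option linter.unusedSectionVars false

variable {n : ℕ} {X : Type} [Fintype X] [DecidableEq X]

/-- Unnormalized acceptance function of the rectangle `u × v`. -/
def AccS (g : X → X → Bool) (u v : (Fin n → X) → ℝ) (z : Fin n → Bool) : ℝ :=
  ∑ x, ∑ y, u x * v y * ∏ i, (1 + sgn (z i) * sgn (g (x i) (y i)))

/-- Total mass. -/
def tot (u : (Fin n → X) → ℝ) : ℝ := ∑ x, u x

/-- Restriction to `x_J = α`. -/
def restr (u : (Fin n → X) → ℝ) (J : Finset (Fin n)) (α : J → X) : (Fin n → X) → ℝ :=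
  fun x => if J.restrict x = α then u x else 0

/-- Restriction to `x_J ≠ α`. -/
def corestr (u : (Fin n → X) → ℝ) (J : Finset (Fin n)) (α : J → X) : (Fin n → X) → ℝ :=
  fun x => if J.restrict x = α then 0 else u x

lemma tot_nonneg {u : (Fin n → X) → ℝ} (hu : ∀ x, 0 ≤ u x) : 0 ≤ tot u :=
  Finset.sum_nonneg fun x _ => hu x

lemma restr_nonneg {u : (Fin n → X) → ℝ} (hu : ∀ x, 0 ≤ u x) (J : Finset (Fin n)) (α : J → X)
    (x) : 0 ≤ restr u J α x := by
  unfold restr; split_ifs; exacts [hu x, le_rfl]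

lemma corestr_nonneg {u : (Fin n → X) → ℝ} (hu : ∀ x, 0 ≤ u x) (J : Finset (Fin n)) (α : J → X)
    (x) : 0 ≤ corestr u J α x := by
  unfold corestr; split_ifs; exacts [le_rfl, hu x]

lemma restr_le {u : (Fin n → X) → ℝ} (hu : ∀ x, 0 ≤ u x) (J : Finset (Fin n)) (α : J → X)
    (x) : restr u J α x ≤ u x := by
  unfold restr; split_ifs; exacts [le_rfl, hu x]

lemma corestr_le {u : (Fin n → X) → ℝ} (hu : ∀ x, 0 ≤ u x) (J : Finset (Fin n)) (α : J → X)
    (x) : corestr u J α x ≤ u x := by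
  unfold corestr; split_ifs; exacts [hu x, le_rfl]

lemma restr_add_corestr (u : (Fin n → X) → ℝ) (J : Finset (Fin n)) (α : J → X) (x) :
    restr u J α x + corestr u J α x = u x := by
  unfold restr corestr; split_ifs <;> simp

lemma tot_restr_add (u : (Fin n → X) → ℝ) (J : Finset (Fin n)) (α : J → X) :
    tot (restr u J α) + tot (corestr u J α) = tot u := by
  unfold tot
  rw [← Finset.sum_add_distrib]
  exact Finset.sum_congr rfl fun x _ => restr_add_corestr u J α x

lemma sum_restr (u : (Fin n → X) → ℝ) (J : Finset (Fin n)) (x) :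
    ∑ α, restr u J α x = u x := by
  unfold restr; simp

lemma sum_tot_restr (u : (Fin n → X) → ℝ) (J : Finset (Fin n)) :
    ∑ α, tot (restr u J α) = tot u := by
  unfold tot
  rw [Finset.sum_comm]
  exact Finset.sum_congr rfl fun x _ => sum_restr u J x

lemma AccS_nonneg (g : X → X → Bool) {u v : (Fin n → X) → ℝ} (hu : ∀ x, 0 ≤ u x)
    (hv : ∀ x, 0 ≤ v x) (z) : 0 ≤ AccS g u v z :=
  Finset.sum_nonneg fun x _ => Finset.sum_nonneg fun y _ =>
    mul_nonneg (mul_nonneg (hu x) (hv y)) (Finset.prod_nonneg fun _ _ => one_add_sgn_nonneg _ _)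

lemma AccS_swap (g : X → X → Bool) (u v : (Fin n → X) → ℝ) (z) :
    AccS g u v z = AccS (fun a b => g b a) v u z := by
  unfold AccS
  rw [Finset.sum_comm]
  exact Finset.sum_congr rfl fun x _ => Finset.sum_congr rfl fun y _ => by ring

lemma uexp_AccS (g : X → X → Bool) (u v : (Fin n → X) → ℝ) :
    uexp (AccS g u v) = tot u * tot v := by
  unfold uexp AccS tot
  rw [Finset.sum_comm]
  have : ∀ x : Fin n → X, ∑ z : Fin n → Bool, ∑ y, u x * v y *
      ∏ i, (1 + sgn (z i) * sgn (g (x i) (y i))) = u x * (∑ y, v y) * 2 ^ n := by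
    intro x
    rw [Finset.sum_comm]
    simp_rw [← Finset.mul_sum]
    rw [Finset.mul_sum, Finset.sum_mul]
    refine Finset.sum_congr rfl fun y _ => ?_
    rw [sum_prod_one_add (fun i => g (x i) (y i))]
  simp_rw [this]
  rw [← Finset.sum_mul, ← Finset.sum_mul]
  simp

lemma AccS_split (g : X → X → Bool) (u v : (Fin n → X) → ℝ) (J : Finset (Fin n)) (α : J → X)
    (z) : AccS g u v z = AccS g (corestr u J α) v z +
      ∑ β : J → X, AccS g (restr u J α) (restr v J β) z := by
  unfold AccS
  have h : ∀ x, (∑ β : J → X, ∑ y, restr u J α x * restr v J β y *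
      ∏ i, (1 + sgn (z i) * sgn (g (x i) (y i)))) = ∑ y, restr u J α x * v y *
      ∏ i, (1 + sgn (z i) * sgn (g (x i) (y i))) := by
    intro x
    rw [Finset.sum_comm]
    refine Finset.sum_congr rfl fun y _ => ?_
    rw [← Finset.sum_mul, ← Finset.mul_sum, sum_restr]
  have h' : (∑ β : J → X, ∑ x, ∑ y, restr u J α x * restr v J β y *
      ∏ i, (1 + sgn (z i) * sgn (g (x i) (y i)))) = ∑ x, ∑ y, restr u J α x * v y *
      ∏ i, (1 + sgn (z i) * sgn (g (x i) (y i))) := by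
    rw [Finset.sum_comm]
    exact Finset.sum_congr rfl fun x _ => h x
  rw [h', ← Finset.sum_add_distrib]
  refine Finset.sum_congr rfl fun x _ => ?_
  rw [← Finset.sum_add_distrib]
  refine Finset.sum_congr rfl fun y _ => ?_
  rw [← restr_add_corestr u J α x]
  ring

/-- Fourier coefficient of the acceptance function. -/
def aco (g : X → X → Bool) (u v : (Fin n → X) → ℝ) (S : Finset (Fin n)) : ℝ :=
  ∑ x, ∑ y, u x * v y * ∏ i ∈ S, sgn (g (x i) (y i))

/-- Discrepancy-type bound. -/
def DiscBound (g : X → X → Bool) (B : ℝ) : Prop :=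
  ∀ x, ∑ x', |∑ y, sgn (g x y) * sgn (g x' y)| ≤ B

lemma aco_eq (g : X → X → Bool) (u v : (Fin n → X) → ℝ) (S : Finset (Fin n)) :
    aco g u v S = ∑ β : S → X, tot (restr v S β) *
      ∑ α : S → X, tot (restr u S α) * ∏ i, sgn (g (α i) (β i)) := by
  unfold aco tot
  have h1 : ∀ (x y : Fin n → X), u x * v y * ∏ i ∈ S, sgn (g (x i) (y i)) =
      ∑ β : S → X, ∑ α : S → X, restr v S β y * (restr u S α x * ∏ i, sgn (g (α i) (β i))) := by
    intro x y
    unfold restr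
    simp only [ite_mul, zero_mul, mul_ite, mul_zero, Finset.sum_ite_eq, Finset.mem_univ, if_true]
    rw [← Finset.prod_coe_sort S]
    simp only [Finset.restrict]
    ring
  simp_rw [h1, Finset.sum_mul, Finset.mul_sum]
  rw [Finset.sum_comm]
  have h2 : ∀ y : Fin n → X, (∑ x : Fin n → X, ∑ β : S → X, ∑ α : S → X,
      restr v S β y * (restr u S α x * ∏ i, sgn (g (α i) (β i)))) =
      ∑ β : S → X, ∑ α : S → X, ∑ x : Fin n → X,
      restr v S β y * (restr u S α x * ∏ i, sgn (g (α i) (β i))) := by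
    intro y
    rw [Finset.sum_comm]
    exact Finset.sum_congr rfl fun β _ => Finset.sum_comm
  simp_rw [h2]
  rw [Finset.sum_comm]

lemma aco_bound (g : X → X → Bool) {B : ℝ} (hg : DiscBound g B)
    {u v : (Fin n → X) → ℝ} (hu : ∀ x, 0 ≤ u x) (hv : ∀ x, 0 ≤ v x) (S : Finset (Fin n))
    (p q : ℝ) (hp : ∀ α, tot (restr u S α) ≤ p) (hq : ∀ α, tot (restr v S α) ≤ q) :
    (aco g u v S) ^ 2 ≤ (q * tot v) * (p * tot u * B ^ S.card) := by
  rw [aco_eq]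
  set P : (S → X) → ℝ := fun α => tot (restr u S α) with hP
  set R : (S → X) → ℝ := fun α => tot (restr v S α) with hR
  have hP0 : ∀ α, 0 ≤ P α := fun α => tot_nonneg (restr_nonneg hu S α)
  have hR0 : ∀ α, 0 ≤ R α := fun α => tot_nonneg (restr_nonneg hv S α)
  have hPs : ∑ α, P α = tot u := sum_tot_restr u S
  have hRs : ∑ α, R α = tot v := sum_tot_restr v S
  refine (Finset.sum_mul_sq_le_sq_mul_sq _ _ _).trans ?_
  have e1 : ∑ β, R β ^ 2 ≤ q * tot v := by
    rw [← hRs, Finset.mul_sum]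
    refine Finset.sum_le_sum fun β _ => ?_
    rw [sq]
    exact mul_le_mul_of_nonneg_right (hq β) (hR0 β)
  have e2 : ∑ β : S → X, (∑ α : S → X, P α * ∏ i, sgn (g (α i) (β i))) ^ 2 ≤
      p * tot u * B ^ S.card := by
    have h3 : ∀ β : S → X, (∑ α : S → X, P α * ∏ i, sgn (g (α i) (β i))) ^ 2 =
        ∑ α : S → X, ∑ α' : S → X, P α * P α' *
          ∏ i, (sgn (g (α i) (β i)) * sgn (g (α' i) (β i))) := by
      intro β
      rw [sq, Finset.sum_mul_sum]
      refine Finset.sum_congr rfl fun α _ => Finset.sum_congr rfl fun α' _ => ?_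
      rw [Finset.prod_mul_distrib]
      ring
    simp_rw [h3]
    rw [Finset.sum_comm]
    have h4 : ∀ α : S → X, ∑ β : S → X, ∑ α' : S → X, P α * P α' *
          ∏ i, (sgn (g (α i) (β i)) * sgn (g (α' i) (β i))) ≤ P α * (p * B ^ S.card) := by
      intro α
      rw [Finset.sum_comm]
      have h5 : ∀ α' : S → X, ∑ β : S → X, P α * P α' *
          ∏ i, (sgn (g (α i) (β i)) * sgn (g (α' i) (β i))) ≤
          P α * p * ∏ i, |∑ y, sgn (g (α i) y) * sgn (g (α' i) y)| := by
        intro α'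
        rw [← Finset.mul_sum]
        have := Fintype.prod_sum (fun (i : S) (y : X) => sgn (g (α i) y) * sgn (g (α' i) y))
        rw [← this]
        calc P α * P α' * ∏ i : S, ∑ y, sgn (g (α i) y) * sgn (g (α' i) y)
            ≤ P α * P α' * |∏ i : S, ∑ y, sgn (g (α i) y) * sgn (g (α' i) y)| :=
              mul_le_mul_of_nonneg_left (le_abs_self _) (mul_nonneg (hP0 _) (hP0 _))
          _ ≤ P α * p * |∏ i : S, ∑ y, sgn (g (α i) y) * sgn (g (α' i) y)| := by
              gcongr
              · exact hP0 _
              · exact hp α'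
          _ = _ := by rw [Finset.abs_prod]
      refine (Finset.sum_le_sum fun α' _ => h5 α').trans ?_
      rw [← Finset.mul_sum, mul_assoc]
      refine mul_le_mul_of_nonneg_left ?_ (hP0 α)
      refine mul_le_mul_of_nonneg_left ?_ ((hP0 α).trans (hp α))
      have := Fintype.prod_sum (fun (i : S) (x' : X) =>
        |∑ y, sgn (g (α i) y) * sgn (g x' y)|)
      rw [← this]
      calc ∏ i : S, ∑ x', |∑ y, sgn (g (α i) y) * sgn (g x' y)| ≤ ∏ _i : S, B :=
            Finset.prod_le_prod (fun i _ => Finset.sum_nonneg fun _ _ => abs_nonneg _)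
              (fun i _ => hg (α i))
        _ = B ^ S.card := by simp
    refine (Finset.sum_le_sum fun α _ => h4 α).trans ?_
    rw [← Finset.sum_mul, hPs]
    apply le_of_eq
    ring
  have e3 : 0 ≤ ∑ β : S → X, (∑ α : S → X, P α * ∏ i, sgn (g (α i) (β i))) ^ 2 :=
    Finset.sum_nonneg fun _ _ => sq_nonneg _
  have e4 : 0 ≤ ∑ β, R β ^ 2 := Finset.sum_nonneg fun _ _ => sq_nonneg _
  exact mul_le_mul e1 e2 e3 (e4.trans e1)

end Rect

set_option linter.unusedSectionVars false

section Leaf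

variable {n : ℕ} {X : Type} [Fintype X] [DecidableEq X]

lemma chi_abs (S : Finset (Fin n)) (z : Fin n → Bool) : |chi S z| = 1 := by
  unfold chi
  rw [Finset.abs_prod]
  simp [sgn_abs]

lemma aco_empty (g : X → X → Bool) (u v : (Fin n → X) → ℝ) :
    aco g u v ∅ = tot u * tot v := by
  unfold aco tot
  rw [Finset.sum_mul_sum]
  simp

lemma AccS_expand (g : X → X → Bool) (u v : (Fin n → X) → ℝ) (I : Finset (Fin n))
    (c : Fin n → Bool)
    (hc : ∀ x y, u x ≠ 0 → v y ≠ 0 → ∀ i ∈ I, g (x i) (y i) = c i) (z : Fin n → Bool) :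
    AccS g u v z = conj I c z * ∑ S ∈ Iᶜ.powerset, aco g u v S * chi S z := by
  have h1 : ∀ x y, u x * v y * ∏ i, (1 + sgn (z i) * sgn (g (x i) (y i))) =
      conj I c z * ∑ S ∈ Iᶜ.powerset, u x * v y * (∏ i ∈ S, sgn (g (x i) (y i))) * chi S z := by
    intro x y
    by_cases hx : u x = 0
    · simp [hx]
    by_cases hy : v y = 0
    · simp [hy]
    rw [← Finset.prod_mul_prod_compl I, Finset.prod_one_add Iᶜ]
    have h2 : ∏ i ∈ I, (1 + sgn (z i) * sgn (g (x i) (y i))) = conj I c z := by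
      unfold conj
      exact Finset.prod_congr rfl fun i hi => by rw [hc x y hx hy i hi]
    rw [h2]
    have h3 : ∀ S, u x * v y * (∏ i ∈ S, sgn (g (x i) (y i))) * chi S z =
        u x * v y * ∏ i ∈ S, (sgn (z i) * sgn (g (x i) (y i))) := by
      intro S
      rw [Finset.prod_mul_distrib]
      unfold chi
      ring
    simp_rw [h3]
    rw [← Finset.mul_sum]
    ring
  unfold AccS
  simp_rw [h1, ← Finset.mul_sum]
  congr 1
  unfold aco
  simp_rw [Finset.sum_mul]
  rw [Finset.sum_comm]
  rw [Finset.sum_comm]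
  have h4 : ∀ x : Fin n → X, (∑ y, ∑ S ∈ Iᶜ.powerset,
      u x * v y * (∏ i ∈ S, sgn (g (x i) (y i))) * chi S z) = ∑ S ∈ Iᶜ.powerset, ∑ y,
      u x * v y * (∏ i ∈ S, sgn (g (x i) (y i))) * chi S z := fun x => Finset.sum_comm
  simp_rw [h4]
  rw [Finset.sum_comm]

/-- Tail of the binomial expansion. -/
def tailS (n k : ℕ) (ε : ℝ) : ℝ :=
  ∑ S ∈ (Finset.univ : Finset (Finset (Fin n))).filter (fun S => k < S.card), ε ^ S.card

lemma tailS_nonneg (n k : ℕ) {ε : ℝ} (hε : 0 ≤ ε) : 0 ≤ tailS n k ε :=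
  Finset.sum_nonneg fun _ _ => by positivity

lemma sum_all_pow (n : ℕ) (ε : ℝ) : ∑ S : Finset (Fin n), ε ^ S.card = (1 + ε) ^ n := by
  have := Fintype.sum_pow_mul_eq_add_pow (Fin n) ε 1
  simpa [add_comm] using this

lemma sum_powerset_split (I : Finset (Fin n)) (k : ℕ) (h : Finset (Fin n) → ℝ) :
    ∑ S ∈ Iᶜ.powerset, h S = h ∅ +
      ∑ S ∈ Iᶜ.powerset.filter (fun S => S ≠ ∅ ∧ S.card ≤ k), h S +
      ∑ S ∈ Iᶜ.powerset.filter (fun S => k < S.card), h S := by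
  rw [← Finset.sum_filter_add_sum_filter_not Iᶜ.powerset (fun S => k < S.card), add_comm]
  congr 1
  have : Iᶜ.powerset.filter (fun S => ¬ k < S.card) =
      insert ∅ (Iᶜ.powerset.filter (fun S => S ≠ ∅ ∧ S.card ≤ k)) := by
    ext S
    simp only [Finset.mem_filter, Finset.mem_powerset, Finset.mem_insert, not_lt]
    constructor
    · rintro ⟨h1, h2⟩
      by_cases hS : S = ∅
      · exact Or.inl hS
      · exact Or.inr ⟨h1, hS, h2⟩
    · rintro (rfl | ⟨h1, _, h2⟩)
      · simp
      · exact ⟨h1, h2⟩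
  rw [this, Finset.sum_insert (by simp)]

lemma leaf (g : X → X → Bool) {u v : (Fin n → X) → ℝ} (hu : ∀ x, 0 ≤ u x)
    (hv : ∀ x, 0 ≤ v x) (I : Finset (Fin n)) (c : Fin n → Bool)
    (hc : ∀ x y, u x ≠ 0 → v y ≠ 0 → ∀ i ∈ I, g (x i) (y i) = c i)
    {ε : ℝ} (hε0 : 0 ≤ ε) (hε : (1 + ε) ^ n ≤ 2)
    (ha : ∀ S, S ⊆ Iᶜ → |aco g u v S| ≤ tot u * tot v * ε ^ S.card)
    {k d : ℕ} (hI : I.card ≤ k) (hd : 2 * k ≤ d) :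
    Good d (AccS g u v) (2 * tailS n k ε * (tot u * tot v)) := by
  set m := tot u * tot v with hm
  have hm0 : 0 ≤ m := mul_nonneg (tot_nonneg hu) (tot_nonneg hv)
  set low := Iᶜ.powerset.filter (fun S => S ≠ ∅ ∧ S.card ≤ k) with hlow
  set high := Iᶜ.powerset.filter (fun S => k < S.card) with hhigh
  set a := aco g u v with haco
  have ht0 := tailS_nonneg n k hε0
  have hlowsum : ∑ S ∈ low, |a S| ≤ m * ∑ S ∈ low, ε ^ S.card := by
    rw [Finset.mul_sum]
    refine Finset.sum_le_sum fun S hS => ha S ?_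
    simp only [hlow, Finset.mem_filter, Finset.mem_powerset] at hS
    exact hS.1
  have htot : 1 + ∑ S ∈ low, ε ^ S.card + tailS n k ε ≤ 2 := by
    rw [← sum_all_pow] at hε
    refine le_trans ?_ hε
    rw [← Finset.sum_filter_add_sum_filter_not Finset.univ (fun S : Finset (Fin n) => k < S.card),
      add_comm]
    refine add_le_add le_rfl ?_
    have : (1 : ℝ) = ε ^ (∅ : Finset (Fin n)).card := by simp
    rw [this, ← Finset.sum_insert (f := fun S : Finset (Fin n) => ε ^ S.card)
      (by simp [hlow] : (∅ : Finset (Fin n)) ∉ low)]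
    refine Finset.sum_le_sum_of_subset_of_nonneg ?_ (fun _ _ _ => by positivity)
    intro S hS
    simp only [hlow, Finset.mem_filter, Finset.mem_powerset, Finset.mem_insert] at hS
    simp only [Finset.mem_filter, Finset.mem_univ, true_and, not_lt]
    rcases hS with rfl | ⟨_, _, h⟩
    · simp
    · exact h
  have hconst : 0 ≤ m - ∑ S ∈ low, |a S| - m * tailS n k ε := by nlinarith
  have hhighb : ∀ z, |∑ S ∈ high, a S * chi S z| ≤ m * tailS n k ε := by
    intro z
    refine (Finset.abs_sum_le_sum_abs _ _).trans ?_
    unfold tailS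
    rw [Finset.mul_sum]
    calc ∑ S ∈ high, |a S * chi S z| ≤ ∑ S ∈ high, m * ε ^ S.card := by
          refine Finset.sum_le_sum fun S hS => ?_
          rw [abs_mul, chi_abs, mul_one]
          simp only [hhigh, Finset.mem_filter, Finset.mem_powerset] at hS
          exact ha S hS.1
      _ ≤ _ := by
          refine Finset.sum_le_sum_of_subset_of_nonneg ?_ (fun _ _ _ => by positivity)
          intro S hS
          simp only [hhigh, Finset.mem_filter] at hS
          simp [hS.2]
  have hconjJ : ∀ (z z' : Fin n → Bool), (∀ i ∈ I, z i = z' i) → conj I c z = conj I c z' := by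
    intro z z' h
    unfold conj
    exact Finset.prod_congr rfl fun i hi => by rw [h i hi]
  refine ⟨fun z => conj I c z * (m - ∑ S ∈ low, |a S| - m * tailS n k ε) +
      ∑ S ∈ low, conj I c z * (|a S| + a S * chi S z),
    fun z => conj I c z * (m * tailS n k ε + ∑ S ∈ high, a S * chi S z), ?_, ?_, ?_, ?_⟩
  · apply InCone.add
    · refine InCone.of_junta I (by omega) _ (fun z => mul_nonneg (conj_nonneg _ _ _) hconst) ?_
      intro z z' h
      rw [hconjJ z z' h]
    · apply InCone.sum
      intro S hS
      simp only [hlow, Finset.mem_filter, Finset.mem_powerset] at hS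
      refine InCone.of_junta (I ∪ S) ?_ _ ?_ ?_
      · have := Finset.card_union_le I S
        omega
      · intro z
        refine mul_nonneg (conj_nonneg _ _ _) ?_
        have : |a S * chi S z| = |a S| := by rw [abs_mul, chi_abs, mul_one]
        have := neg_abs_le (a S * chi S z)
        linarith
      · intro z z' h
        rw [hconjJ z z' (fun i hi => h i (Finset.mem_union_left _ hi))]
        have : chi S z = chi S z' := by
          unfold chi
          exact Finset.prod_congr rfl fun i hi => by rw [h i (Finset.mem_union_right _ hi)]
        rw [this]
  · intro z
    refine mul_nonneg (conj_nonneg _ _ _) ?_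
    have := neg_abs_le (∑ S ∈ high, a S * chi S z)
    linarith [hhighb z]
  · calc uexp (fun z => conj I c z * (m * tailS n k ε + ∑ S ∈ high, a S * chi S z))
        ≤ uexp (fun z => conj I c z * (2 * tailS n k ε * m)) := by
          refine uexp_mono fun z => mul_le_mul_of_nonneg_left ?_ (conj_nonneg _ _ _)
          have := le_abs_self (∑ S ∈ high, a S * chi S z)
          linarith [hhighb z]
      _ = 2 * tailS n k ε * m := by
          rw [uexp_mul_right, uexp_conj, one_mul]
  · intro z
    rw [AccS_expand g u v I c hc z, sum_powerset_split I k, ← haco]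
    have h0 : a ∅ * chi ∅ z = m := by
      rw [haco, aco_empty]; simp [chi, hm]
    rw [h0]
    beta_reduce
    rw [← Finset.mul_sum, Finset.sum_add_distrib]
    ring

end Leaf


set_option linter.unusedSectionVars false

section Main

variable {n : ℕ} {X : Type} [Fintype X] [DecidableEq X]

/-- The coordinates in `I` are constant on the support of `u`. -/
def Fixed (u : (Fin n → X) → ℝ) (I : Finset (Fin n)) : Prop :=
  ∀ x x', u x ≠ 0 → u x' ≠ 0 → ∀ i ∈ I, x i = x' i

lemma Fixed.corestr {u : (Fin n → X) → ℝ} {I : Finset (Fin n)} (h : Fixed u I)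
    (J : Finset (Fin n)) (α : J → X) : Fixed (corestr u J α) I := by
  intro x x' hx hx'
  unfold _root_.corestr at hx hx'
  exact h x x' (fun h0 => hx (by simp [h0])) (fun h0 => hx' (by simp [h0]))

lemma Fixed.restr {u : (Fin n → X) → ℝ} {I : Finset (Fin n)} (h : Fixed u I)
    (J : Finset (Fin n)) (α : J → X) : Fixed (restr u J α) (I ∪ J) := by
  intro x x' hx hx' i hi
  unfold _root_.restr at hx hx'
  have e1 : J.restrict x = α := by
    by_contra h0; exact hx (by simp [h0])
  have e2 : J.restrict x' = α := by
    by_contra h0; exact hx' (by simp [h0])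
  rcases Finset.mem_union.1 hi with hi | hi
  · exact h x x' (fun h0 => hx (by simp [h0])) (fun h0 => hx' (by simp [h0])) i hi
  · have := congrFun (e1.trans e2.symm) ⟨i, hi⟩
    simpa [Finset.restrict] using this

lemma tot_le_of_fixed {u : (Fin n → X) → ℝ} {I : Finset (Fin n)} (h : Fixed u I)
    (Q U : ℝ) (hQ : (Fintype.card X : ℝ) = Q) (hQ0 : 0 < Q) (hU : 0 ≤ U)
    (hu : ∀ x, u x * Q ^ n ≤ U) : tot u ≤ U * (Q⁻¹) ^ I.card := by
  by_cases h0 : ∃ x0, u x0 ≠ 0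
  · obtain ⟨x0, hx0⟩ := h0
    have h1 : ∀ x, u x * Q ^ n ≤ U * ∏ i, (if i ∈ I then (if x i = x0 i then (1 : ℝ) else 0)
        else 1) := by
      intro x
      by_cases hx : u x = 0
      · rw [hx, zero_mul]
        refine mul_nonneg hU (Finset.prod_nonneg fun i _ => ?_)
        split_ifs <;> norm_num
      · rw [Finset.prod_eq_one, mul_one]
        · exact hu x
        · intro i _
          by_cases hi : i ∈ I
          · simp [hi, h x x0 hx hx0 i hi]
          · simp [hi]
    have h2 : tot u * Q ^ n ≤ U * ∏ i : Fin n, (if i ∈ I then (1 : ℝ) else Q) := by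
      unfold tot
      rw [Finset.sum_mul]
      refine (Finset.sum_le_sum fun x _ => h1 x).trans (le_of_eq ?_)
      rw [← Finset.mul_sum]
      congr 1
      have := Fintype.prod_sum (fun (i : Fin n) (c : X) =>
        (if i ∈ I then (if c = x0 i then (1 : ℝ) else 0) else 1))
      rw [← this]
      refine Finset.prod_congr rfl fun i _ => ?_
      by_cases hi : i ∈ I
      · simp [hi]
      · simp [hi, hQ]
    have h3 : (∏ i : Fin n, (if i ∈ I then (1 : ℝ) else Q)) = (Q⁻¹) ^ I.card * Q ^ n := by
      have e1 : (Q⁻¹) ^ I.card = ∏ i : Fin n, (if i ∈ I then Q⁻¹ else 1) := by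
        rw [Finset.prod_ite_mem]; simp
      have e2 : Q ^ n = ∏ _i : Fin n, Q := by simp
      rw [e1, e2, ← Finset.prod_mul_distrib]
      refine Finset.prod_congr rfl fun i _ => ?_
      by_cases hi : i ∈ I
      · simp [hi, hQ0.ne']
      · simp [hi]
    rw [h3, ← mul_assoc] at h2
    exact le_of_mul_le_mul_right h2 (by positivity)
  · push Not at h0
    have : tot u = 0 := by unfold tot; simp [h0]
    rw [this]
    positivity

lemma sqrt_step {a s t ρ W : ℝ} (ha : 0 ≤ a) (hs : 0 ≤ s) (ht : 0 ≤ t) (hρ : 0 ≤ ρ)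
    (h1 : a ^ 2 + s ^ 2 = t ^ 2) (h2 : t ≤ s * W) (h3 : ρ * W ≤ 1 / 2) : a + s * ρ ≤ t := by
  by_contra hcon
  push Not at hcon
  have hat : a ≤ t := by
    exact le_of_abs_le (abs_le_of_sq_le_sq (by nlinarith [sq_nonneg s]) ht)
  rcases eq_or_lt_of_le ht with h0 | h0
  · have : s = 0 := by nlinarith
    subst this
    simp at hcon
    linarith
  · have e1 : (t - a) * (t + a) < s * ρ * (t + a) := by
      apply mul_lt_mul_of_pos_right _ (by linarith)
      linarith
    have e2 : s * ρ * (t + a) ≤ s * ρ * (2 * (s * W)) := by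
      apply mul_le_mul_of_nonneg_left _ (by positivity)
      linarith
    have e3 : s * ρ * (2 * (s * W)) ≤ s ^ 2 := by
      have : s * ρ * (2 * (s * W)) = s ^ 2 * (2 * (ρ * W)) := by ring
      rw [this]
      nlinarith [sq_nonneg s]
    nlinarith

lemma step (g : X → X → Bool) {u v : (Fin n → X) → ℝ} (hu : ∀ x, 0 ≤ u x) (hv : ∀ x, 0 ≤ v x)
    {w : ℝ} (hw : 0 < w) (hQ : (Fintype.card X : ℝ) = w ^ 8)
    (J : Finset (Fin n)) (hJ : J.Nonempty) (α : J → X)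
    (hviol : tot u < tot (restr u J α) * (w ^ 6) ^ J.card) {d : ℕ} {T K : ℝ} (hK : 0 ≤ K)
    (hco : Good d (AccS g (corestr u J α) v)
      (T * (tot (corestr u J α) * tot v) + √(tot (corestr u J α)) * √(tot v) * K))
    (hch : ∀ β, Good d (AccS g (restr u J α) (restr v J β))
      (T * (tot (restr u J α) * tot (restr v J β)) +
        √(tot (restr u J α)) * √(tot (restr v J β)) * (K * ((2 * w ^ 7)⁻¹) ^ J.card))) :
    Good d (AccS g u v) (T * (tot u * tot v) + √(tot u) * √(tot v) * K) := by
  have hG := hco.add (Good.sum Finset.univ _ _ fun β _ => hch β)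
  have hA : AccS g u v = fun z => AccS g (corestr u J α) v z +
      ∑ β : J → X, AccS g (restr u J α) (restr v J β) z := funext (AccS_split g u v J α)
  rw [hA]
  refine hG.mono ?_
  set c := tot (corestr u J α) with hc
  set r := tot (restr u J α) with hr
  have hc0 : 0 ≤ c := tot_nonneg (corestr_nonneg hu J α)
  have hr0 : 0 ≤ r := tot_nonneg (restr_nonneg hu J α)
  have hv0 : 0 ≤ tot v := tot_nonneg hv
  have hu0 : 0 ≤ tot u := tot_nonneg hu
  have hsum : r + c = tot u := tot_restr_add u J α
  have hvs : ∑ β, tot (restr v J β) = tot v := sum_tot_restr v J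
  have hsq : ∑ β : J → X, √(tot (restr v J β)) ≤ (w ^ 4) ^ J.card * √(tot v) := by
    have h1 := Real.sum_sqrt_mul_sqrt_le (f := fun _ : J → X => (1 : ℝ))
      (g := fun β => tot (restr v J β)) Finset.univ (fun _ => zero_le_one)
      (fun β => tot_nonneg (restr_nonneg hv J β))
    rw [hvs] at h1
    simp only [Real.sqrt_one, one_mul, Finset.sum_const, Finset.card_univ, nsmul_eq_mul,
      mul_one] at h1
    refine h1.trans (le_of_eq ?_)
    congr 1
    rw [Fintype.card_fun, Nat.cast_pow, hQ, Fintype.card_coe]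
    rw [show (w ^ 8) ^ J.card = ((w ^ 4) ^ J.card) ^ 2 by ring]
    exact Real.sqrt_sq (by positivity)
  set ρ : ℝ := (w ^ 4) ^ J.card * ((2 * w ^ 7)⁻¹) ^ J.card with hρ
  have hρ0 : 0 ≤ ρ := by positivity
  have key : √c + √r * ρ ≤ √(tot u) := by
    refine sqrt_step (W := (w ^ 3) ^ J.card) (Real.sqrt_nonneg _) (Real.sqrt_nonneg _)
      (Real.sqrt_nonneg _) hρ0 ?_ ?_ ?_
    · rw [Real.sq_sqrt hc0, Real.sq_sqrt hr0, Real.sq_sqrt hu0]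
      linarith
    · have : (w ^ 3) ^ J.card = √((w ^ 6) ^ J.card) := by
        rw [show (w ^ 6) ^ J.card = ((w ^ 3) ^ J.card) ^ 2 by ring]
        rw [Real.sqrt_sq (by positivity)]
      rw [this, ← Real.sqrt_mul hr0]
      exact Real.sqrt_le_sqrt hviol.le
    · rw [hρ, ← mul_pow, ← mul_pow]
      have : w ^ 4 * (2 * w ^ 7)⁻¹ * w ^ 3 = 1 / 2 := by
        field_simp
      rw [this]
      calc (1 / 2 : ℝ) ^ J.card ≤ (1 / 2) ^ 1 :=
            pow_le_pow_of_le_one (by norm_num) (by norm_num) hJ.card_pos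
        _ = 1 / 2 := by norm_num
  have e1 : ∑ β : J → X, (T * (r * tot (restr v J β)) +
        √r * √(tot (restr v J β)) * (K * ((2 * w ^ 7)⁻¹) ^ J.card)) =
      T * (r * tot v) + √r * (K * ((2 * w ^ 7)⁻¹) ^ J.card) * ∑ β, √(tot (restr v J β)) := by
    rw [Finset.sum_add_distrib, ← Finset.mul_sum, ← Finset.mul_sum, hvs, Finset.mul_sum]
    congr 1
    exact Finset.sum_congr rfl fun β _ => by ring
  rw [e1]
  have e2 : √r * (K * ((2 * w ^ 7)⁻¹) ^ J.card) * ∑ β, √(tot (restr v J β)) ≤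
      √r * (K * ((2 * w ^ 7)⁻¹) ^ J.card) * ((w ^ 4) ^ J.card * √(tot v)) :=
    mul_le_mul_of_nonneg_left hsq (by positivity)
  have e3 : (√c + √r * ρ) * (√(tot v) * K) ≤ √(tot u) * (√(tot v) * K) :=
    mul_le_mul_of_nonneg_right key (by positivity)
  have e4 : √r * (K * ((2 * w ^ 7)⁻¹) ^ J.card) * ((w ^ 4) ^ J.card * √(tot v)) =
      √r * ρ * (√(tot v) * K) := by rw [hρ]; ring
  have e5 : T * (c * tot v) + T * (r * tot v) = T * (tot u * tot v) := by rw [← hsum]; ring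
  linarith

/-- Size of the support. -/
def supp (u : (Fin n → X) → ℝ) : ℕ := (Finset.univ.filter fun x => u x ≠ 0).card

lemma supp_restr_le (u : (Fin n → X) → ℝ) (J : Finset (Fin n)) (α : J → X) :
    supp (restr u J α) ≤ supp u := by
  refine Finset.card_le_card fun x hx => ?_
  simp only [Finset.mem_filter, Finset.mem_univ, true_and] at hx ⊢
  intro h0
  exact hx (by simp [restr, h0])

lemma supp_corestr_lt (u : (Fin n → X) → ℝ) (J : Finset (Fin n)) (α : J → X)
    (h : tot (restr u J α) ≠ 0) : supp (corestr u J α) < supp u := by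
  obtain ⟨x, _, hx⟩ := Finset.exists_ne_zero_of_sum_ne_zero h
  refine Finset.card_lt_card ⟨fun y hy => ?_, fun hsub => ?_⟩
  · simp only [Finset.mem_filter, Finset.mem_univ, true_and] at hy ⊢
    intro h0
    exact hy (by simp [corestr, h0])
  · have hxe : J.restrict x = α := by
      by_contra h0
      exact hx (by simp [restr, h0])
    have hux : u x ≠ 0 := by
      intro h0
      exact hx (by simp [restr, h0])
    have := hsub (show x ∈ Finset.univ.filter fun x => u x ≠ 0 by simpa using hux)
    simp [corestr, hxe] at this

theorem main_ind (g : X → X → Bool) {w : ℝ} (hw : 0 < w) (hg : DiscBound g (4 * w ^ 8))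
    (hQ : (Fintype.card X : ℝ) = w ^ 8) {k d : ℕ} (hd : 2 * k ≤ d)
    (hε : (1 + 2 / w ^ 2) ^ n ≤ 2) {U V Z : ℝ} (hU : 0 ≤ U) (hV : 0 ≤ V) (hZ0 : 0 ≤ Z)
    (hZ : ∀ j, k < j → √U * √V * ((w ^ 8)⁻¹) ^ j ≤ Z * ((2 * w ^ 7)⁻¹) ^ j) :
    ∀ (N : ℕ) (u v : (Fin n → X) → ℝ) (I : Finset (Fin n)), (∀ x, 0 ≤ u x) → (∀ x, 0 ≤ v x) →
      (∀ x, u x * (w ^ 8) ^ n ≤ U) → (∀ x, v x * (w ^ 8) ^ n ≤ V) → Fixed u I → Fixed v I →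
      Iᶜ.card + supp u + supp v ≤ N →
      Good d (AccS g u v) (2 * tailS n k (2 / w ^ 2) * (tot u * tot v) +
        √(tot u) * √(tot v) * (Z * ((2 * w ^ 7)⁻¹) ^ I.card)) := by
  intro N
  induction N using Nat.strong_induction_on with
  | _ N ih =>
  intro u v I hu hv huU hvV hfu hfv hN
  have htu := tot_nonneg hu
  have htv := tot_nonneg hv
  have ht0 := tailS_nonneg n k (ε := 2 / w ^ 2) (by positivity)
  have hcard : ∀ J : Finset (Fin n), J.Nonempty → Disjoint J I →
      (I ∪ J).card = I.card + J.card ∧ (I ∪ J)ᶜ.card < Iᶜ.card := by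
    intro J hJ hJI
    have h1 : (I ∪ J).card = I.card + J.card := Finset.card_union_of_disjoint hJI.symm
    refine ⟨h1, ?_⟩
    have h2 := Finset.card_add_card_compl (I ∪ J)
    have h3 := Finset.card_add_card_compl I
    have := hJ.card_pos
    omega
  rcases lt_or_ge k I.card with hk | hk
  · refine (Good.error (AccS_nonneg g hu hv)).mono ?_
    rw [uexp_AccS]
    have h1 := tot_le_of_fixed hfu (w ^ 8) U hQ (by positivity) hU huU
    have h2 := tot_le_of_fixed hfv (w ^ 8) V hQ (by positivity) hV hvV
    have h3 : √(tot u) * √(tot v) ≤ √U * √V * ((w ^ 8)⁻¹) ^ I.card := by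
      rw [← Real.sqrt_mul htu, ← Real.sqrt_mul hU]
      have : √(U * V) * ((w ^ 8)⁻¹) ^ I.card = √(U * V * (((w ^ 8)⁻¹) ^ I.card) ^ 2) := by
        rw [Real.sqrt_mul (x := U * V) (by positivity) ((((w ^ 8)⁻¹) ^ I.card) ^ 2),
          Real.sqrt_sq (by positivity)]
      rw [this]
      apply Real.sqrt_le_sqrt
      calc tot u * tot v ≤ (U * ((w ^ 8)⁻¹) ^ I.card) * (V * ((w ^ 8)⁻¹) ^ I.card) :=
            mul_le_mul h1 h2 htv (by positivity)
        _ = _ := by ring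
    have h4 := h3.trans (hZ _ hk)
    have h5 : tot u * tot v = √(tot u) * √(tot v) * (√(tot u) * √(tot v)) := by
      have e1 := Real.mul_self_sqrt htu
      have e2 := Real.mul_self_sqrt htv
      calc tot u * tot v = (√(tot u) * √(tot u)) * (√(tot v) * √(tot v)) := by rw [e1, e2]
        _ = _ := by ring
    have h6 : 0 ≤ 2 * tailS n k (2 / w ^ 2) * (tot u * tot v) := by positivity
    have h7 : √(tot u) * √(tot v) * (√(tot u) * √(tot v)) ≤
        √(tot u) * √(tot v) * (Z * ((2 * w ^ 7)⁻¹) ^ I.card) :=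
      mul_le_mul_of_nonneg_left h4 (by positivity)
    linarith
  by_cases hvu : ∃ J : Finset (Fin n), J.Nonempty ∧ Disjoint J I ∧ ∃ α : J → X,
      tot u < tot (restr u J α) * (w ^ 6) ^ J.card
  · obtain ⟨J, hJ, hJI, α, hα⟩ := hvu
    obtain ⟨hc1, hc2⟩ := hcard J hJ hJI
    have hne : tot (restr u J α) ≠ 0 := by
      intro h0
      rw [h0, zero_mul] at hα
      linarith
    refine step g hu hv hw hQ J hJ α hα (by positivity) ?_ ?_
    · have hlt := supp_corestr_lt u J α hne
      refine ih _ ?_ _ _ I (corestr_nonneg hu J α) hv ?_ hvV (hfu.corestr J α) hfv le_rfl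
      · omega
      · exact fun x => (mul_le_mul_of_nonneg_right (corestr_le hu J α x) (by positivity)).trans
          (huU x)
    · intro β
      have hle1 := supp_restr_le u J α
      have hle2 := supp_restr_le v J β
      have := ih ((I ∪ J)ᶜ.card + supp (restr u J α) + supp (restr v J β)) (by omega) _ _ (I ∪ J)
        (restr_nonneg hu J α) (restr_nonneg hv J β)
        (fun x => (mul_le_mul_of_nonneg_right (restr_le hu J α x) (by positivity)).trans (huU x))
        (fun x => (mul_le_mul_of_nonneg_right (restr_le hv J β x) (by positivity)).trans (hvV x))
        (hfu.restr J α) (hfv.restr J β) le_rfl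
      rw [hc1, pow_add, ← mul_assoc Z] at this
      exact this
  by_cases hvv : ∃ J : Finset (Fin n), J.Nonempty ∧ Disjoint J I ∧ ∃ α : J → X,
      tot v < tot (restr v J α) * (w ^ 6) ^ J.card
  · obtain ⟨J, hJ, hJI, α, hα⟩ := hvv
    obtain ⟨hc1, hc2⟩ := hcard J hJ hJI
    have hne : tot (restr v J α) ≠ 0 := by
      intro h0
      rw [h0, zero_mul] at hα
      linarith
    have hsw : ∀ u v : (Fin n → X) → ℝ, AccS g u v = AccS (fun a b => g b a) v u :=
      fun u v => funext (AccS_swap g u v)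
    rw [hsw, mul_comm (tot u), mul_comm √(tot u)]
    refine step _ hv hu hw hQ J hJ α hα (by positivity) ?_ ?_
    · have hlt := supp_corestr_lt v J α hne
      rw [← hsw, mul_comm (tot (corestr v J α)), mul_comm √(tot (corestr v J α))]
      refine ih _ ?_ _ _ I hu (corestr_nonneg hv J α) huU ?_ hfu (hfv.corestr J α) le_rfl
      · omega
      · exact fun x => (mul_le_mul_of_nonneg_right (corestr_le hv J α x) (by positivity)).trans
          (hvV x)
    · intro β
      have hle1 := supp_restr_le u J β
      have hle2 := supp_restr_le v J α
      have := ih ((I ∪ J)ᶜ.card + supp (restr u J β) + supp (restr v J α)) (by omega) _ _ (I ∪ J)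
        (restr_nonneg hu J β) (restr_nonneg hv J α)
        (fun x => (mul_le_mul_of_nonneg_right (restr_le hu J β x) (by positivity)).trans (huU x))
        (fun x => (mul_le_mul_of_nonneg_right (restr_le hv J α x) (by positivity)).trans (hvV x))
        (hfu.restr J β) (hfv.restr J α) le_rfl
      rw [hc1, pow_add, ← mul_assoc Z] at this
      rw [← hsw, mul_comm (tot (restr v J α)), mul_comm √(tot (restr v J α))]
      exact this
  push Not at hvu hvv
  -- both sides are dense: a leaf
  have hbd : ∀ (t : (Fin n → X) → ℝ), (∀ x, 0 ≤ t x) → (∀ J : Finset (Fin n), J.Nonempty →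
      Disjoint J I → ∀ α : J → X, tot (restr t J α) * (w ^ 6) ^ J.card ≤ tot t) →
      ∀ S, S ⊆ Iᶜ → ∀ α : S → X, tot (restr t S α) ≤ tot t * ((w ^ 6)⁻¹) ^ S.card := by
    intro t ht0 ht S hS α
    rcases S.eq_empty_or_nonempty with rfl | hne
    · have := tot_restr_add t ∅ α
      have := tot_nonneg (corestr_nonneg ht0 ∅ α)
      simp only [Finset.card_empty, pow_zero, mul_one]
      linarith
    · have h1 := ht S hne (by
        rw [Finset.disjoint_left]
        intro i hi hI
        exact (Finset.mem_compl.1 (hS hi)) hI) α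
      rw [inv_pow, ← div_eq_mul_inv, le_div_iff₀ (by positivity)]
      exact h1
  have hc : ∃ c : Fin n → Bool, ∀ x y, u x ≠ 0 → v y ≠ 0 → ∀ i ∈ I, g (x i) (y i) = c i := by
    by_cases h0 : ∃ x0 y0, u x0 ≠ 0 ∧ v y0 ≠ 0
    · obtain ⟨x0, y0, hx0, hy0⟩ := h0
      refine ⟨fun i => g (x0 i) (y0 i), fun x y hx hy i hi => ?_⟩
      rw [hfu x x0 hx hx0 i hi, hfv y y0 hy hy0 i hi]
    · push Not at h0
      exact ⟨fun _ => true, fun x y hx hy => absurd (h0 x y hx) hy⟩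
  obtain ⟨c, hc⟩ := hc
  refine (leaf g hu hv I c hc (ε := 2 / w ^ 2) (by positivity) hε ?_ hk hd).mono ?_
  · intro S hS
    have hb := aco_bound g hg hu hv S _ _ (hbd u hu hvu S hS) (hbd v hv hvv S hS)
    apply abs_le_of_sq_le_sq _ (by positivity)
    refine hb.trans (le_of_eq ?_)
    have : (2 / w ^ 2) ^ 2 = (w ^ 6)⁻¹ * (w ^ 6)⁻¹ * (4 * w ^ 8) := by
      field_simp
      ring
    calc tot v * ((w ^ 6)⁻¹) ^ S.card * tot v *
          (tot u * ((w ^ 6)⁻¹) ^ S.card * tot u * (4 * w ^ 8) ^ S.card)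
        = (tot u * tot v) ^ 2 * ((w ^ 6)⁻¹ * (w ^ 6)⁻¹ * (4 * w ^ 8)) ^ S.card := by
          rw [mul_pow ((w ^ 6)⁻¹ * (w ^ 6)⁻¹), mul_pow (w ^ 6)⁻¹]; ring
      _ = _ := by
          rw [← this, mul_pow (tot u * tot v) ((2 / w ^ 2) ^ S.card) 2, ← pow_mul, ← pow_mul,
            mul_comm 2]
  · have : 0 ≤ √(tot u) * √(tot v) * (Z * ((2 * w ^ 7)⁻¹) ^ I.card) := by positivity
    linarith

end Main


set_option linter.unusedSectionVars false

section Core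

variable {n : ℕ} {X : Type} [Fintype X] [DecidableEq X]

lemma sum_row (g : X → X → Bool) (hb : ∀ x, ∑ y, sgn (g x y) = 0) (F : (Fin n → Bool) → ℝ)
    (x : Fin n → X) :
    ∑ y : Fin n → X, F (fun i => g (x i) (y i)) = (Fintype.card X : ℝ) ^ n * uexp F := by
  have h1 : ∀ y : Fin n → X, F (fun i => g (x i) (y i)) =
      ∑ z, F z * (2 ^ n)⁻¹ * ∏ i, (1 + sgn (z i) * sgn (g (x i) (y i))) := by
    intro y
    have h2 : ∀ z : Fin n → Bool, ∏ i, (1 + sgn (z i) * sgn (g (x i) (y i))) =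
        if z = (fun i => g (x i) (y i)) then (2 : ℝ) ^ n else 0 := by
      intro z
      have := conj_eq Finset.univ (fun i => g (x i) (y i)) z
      unfold conj at this
      rw [this]
      by_cases h : z = (fun i => g (x i) (y i))
      · subst h; simp
      · rw [if_neg h, if_neg, mul_zero]
        intro h'
        exact h (funext fun i => h' i (Finset.mem_univ i))
    simp_rw [h2]
    simp
  simp_rw [h1]
  rw [Finset.sum_comm]
  have h3 : ∀ z : Fin n → Bool, ∑ y : Fin n → X, F z * (2 ^ n)⁻¹ *
      ∏ i, (1 + sgn (z i) * sgn (g (x i) (y i))) =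
      F z * (2 ^ n)⁻¹ * (Fintype.card X : ℝ) ^ n := by
    intro z
    rw [← Finset.mul_sum]
    congr 1
    have := Fintype.prod_sum (fun (i : Fin n) (c : X) => (1 + sgn (z i) * sgn (g (x i) c)))
    rw [← this]
    have h4 : ∀ i : Fin n, ∑ c : X, (1 + sgn (z i) * sgn (g (x i) c)) = (Fintype.card X : ℝ) := by
      intro i
      rw [Finset.sum_add_distrib, ← Finset.mul_sum, hb]
      simp
    simp_rw [h4]
    simp
  simp_rw [h3]
  rw [← Finset.sum_mul, ← Finset.sum_mul]
  unfold uexp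
  simp only [Fintype.card_fun, Fintype.card_bool, Fintype.card_fin]
  push_cast
  ring

lemma uexp_point (f : (Fin n → Bool) → ℝ) (z : Fin n → Bool) :
    uexp (fun a => f a * ∏ i, (1 + sgn (z i) * sgn (a i))) = f z := by
  have h2 : ∀ a : Fin n → Bool, ∏ i, (1 + sgn (z i) * sgn (a i)) =
      if a = z then (2 : ℝ) ^ n else 0 := by
    intro a
    have := conj_eq Finset.univ a z
    unfold conj at this
    rw [this]
    by_cases h : a = z
    · subst h; simp
    · rw [if_neg h, if_neg, mul_zero]
      intro h'
      exact h (funext fun i => (h' i (Finset.mem_univ i)).symm)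
  unfold uexp
  simp_rw [h2]
  simp

theorem core {r : ℕ} (g : X → X → Bool) {w : ℝ} (hw : 2 ≤ w) (hg : DiscBound g (4 * w ^ 8))
    (hQ : (Fintype.card X : ℝ) = w ^ 8) (hbx : ∀ x, ∑ y, sgn (g x y) = 0)
    (hby : ∀ y, ∑ x, sgn (g x y) = 0) {k d : ℕ} (hd : 2 * k ≤ d)
    (hε : (1 + 2 / w ^ 2) ^ n ≤ 2) (f : (Fin n → Bool) → ℝ) (hf1 : uexp f = 1)
    (u v : Fin r → (Fin n → X) → ℝ) (hu : ∀ i x, 0 ≤ u i x) (hv : ∀ i x, 0 ≤ v i x)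
    (hf : ∀ x y, f (fun i => g (x i) (y i)) = ∑ i, u i x * v i y) :
    Good d f (2 * tailS n k (2 / w ^ 2) + r * (2 / w) ^ (k + 1)) := by
  have hw0 : 0 < w := by linarith
  set P : ℝ := (w ^ 8) ^ n with hP
  have hP0 : 0 < P := by positivity
  set v' : Fin r → (Fin n → X) → ℝ := fun i y => v i y / P ^ 2 with hv'
  have hv'0 : ∀ i y, 0 ≤ v' i y := fun i y => div_nonneg (hv i y) (by positivity)
  have htv : ∀ i, tot (v' i) = tot (v i) / P ^ 2 := by
    intro i
    unfold tot
    rw [Finset.sum_div]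
  have hsum : ∀ z, f z = ∑ i, AccS g (u i) (v' i) z := by
    intro z
    unfold AccS
    rw [Finset.sum_comm]
    have h1 : ∀ x : Fin n → X, (∑ i, ∑ y, u i x * v' i y *
        ∏ j, (1 + sgn (z j) * sgn (g (x j) (y j)))) = P⁻¹ * f z := by
      intro x
      rw [Finset.sum_comm]
      have h2 : ∀ y : Fin n → X, (∑ i, u i x * v' i y *
          ∏ j, (1 + sgn (z j) * sgn (g (x j) (y j)))) = (P ^ 2)⁻¹ *
          (f (fun i => g (x i) (y i)) * ∏ j, (1 + sgn (z j) * sgn (g (x j) (y j)))) := by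
        intro y
        rw [hf, Finset.sum_mul, Finset.mul_sum]
        refine Finset.sum_congr rfl fun i _ => ?_
        rw [hv']
        ring
      simp_rw [h2]
      rw [← Finset.mul_sum,
        sum_row g hbx (fun a => f a * ∏ j, (1 + sgn (z j) * sgn (a j))) x, uexp_point, hQ, ← hP]
      field_simp
    simp_rw [h1]
    rw [Finset.sum_const, Finset.card_univ, Fintype.card_fun, Fintype.card_fin, nsmul_eq_mul,
      Nat.cast_pow, hQ, ← hP]
    field_simp
  have hlam : ∑ i, tot (u i) * tot (v' i) = 1 := by
    rw [← hf1, show f = fun z => ∑ i, AccS g (u i) (v' i) z from funext hsum]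
    have : ∀ i, tot (u i) * tot (v' i) = uexp (AccS g (u i) (v' i)) :=
      fun i => (uexp_AccS g (u i) (v' i)).symm
    simp_rw [this]
    unfold uexp
    rw [← Finset.sum_div, Finset.sum_comm]
  have hux : ∀ i x, u i x * P * tot (v' i) ≤ 1 := by
    intro i x
    have h1 := sum_row g hbx f x
    rw [hf1, mul_one, hQ, ← hP] at h1
    have h2 : u i x * tot (v i) ≤ P := by
      rw [← h1]
      unfold tot
      rw [Finset.mul_sum]
      refine Finset.sum_le_sum fun y _ => ?_
      rw [hf]
      exact Finset.single_le_sum (f := fun i => u i x * v i y)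
        (fun j _ => mul_nonneg (hu j x) (hv j y)) (Finset.mem_univ i)
    rw [htv]
    calc u i x * P * (tot (v i) / P ^ 2) = (u i x * tot (v i)) / P := by field_simp
      _ ≤ P / P := by gcongr
      _ = 1 := div_self hP0.ne'
  have hvy : ∀ i y, v' i y * P * tot (u i) ≤ 1 := by
    intro i y
    have h1 := sum_row (fun a c => g c a) hby f y
    rw [hf1, mul_one, hQ, ← hP] at h1
    have h2 : v i y * tot (u i) ≤ P := by
      rw [← h1]
      unfold tot
      rw [Finset.mul_sum]
      refine Finset.sum_le_sum fun x _ => ?_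
      rw [hf, mul_comm]
      exact Finset.single_le_sum (f := fun i => u i x * v i y)
        (fun j _ => mul_nonneg (hu j x) (hv j y)) (Finset.mem_univ i)
    calc v i y / P ^ 2 * P * tot (u i) = (v i y * tot (u i)) / P := by field_simp
      _ ≤ P / P := by gcongr
      _ = 1 := div_self hP0.ne'
  have hgood : ∀ i, Good d (AccS g (u i) (v' i))
      (2 * tailS n k (2 / w ^ 2) * (tot (u i) * tot (v' i)) + (2 / w) ^ (k + 1)) := by
    intro i
    have htu0 := tot_nonneg (hu i)
    have htv0 := tot_nonneg (hv'0 i)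
    have ht0 := tailS_nonneg n k (ε := 2 / w ^ 2) (by positivity)
    by_cases h0 : tot (u i) * tot (v' i) = 0
    · refine (Good.error (AccS_nonneg g (hu i) (hv'0 i))).mono ?_
      rw [uexp_AccS, h0, mul_zero, zero_add]
      positivity
    · have hu1 : 0 < tot (u i) := lt_of_le_of_ne htu0 (fun h => h0 (by rw [← h, zero_mul]))
      have hv1 : 0 < tot (v' i) := lt_of_le_of_ne htv0 (fun h => h0 (by rw [← h, mul_zero]))
      have hmain := main_ind (n := n) g hw0 hg hQ hd hε (U := 1 / tot (v' i))
        (V := 1 / tot (u i))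
        (Z := √(1 / tot (v' i)) * √(1 / tot (u i)) * (2 / w) ^ (k + 1))
        (by positivity) (by positivity) (by positivity) ?_ _ (u i) (v' i) ∅ (hu i) (hv'0 i)
        ?_ ?_ (by intro _ _ _ _ j hj; simp at hj) (by intro _ _ _ _ j hj; simp at hj) le_rfl
      · refine hmain.mono (le_of_eq ?_)
        congr 1
        rw [Finset.card_empty, pow_zero, mul_one]
        have e1 : √(tot (u i)) * √(1 / tot (u i)) = 1 := by
          rw [← Real.sqrt_mul hu1.le, mul_one_div_cancel hu1.ne', Real.sqrt_one]
        have e2 : √(tot (v' i)) * √(1 / tot (v' i)) = 1 := by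
          rw [← Real.sqrt_mul hv1.le, mul_one_div_cancel hv1.ne', Real.sqrt_one]
        calc √(tot (u i)) * √(tot (v' i)) *
              (√(1 / tot (v' i)) * √(1 / tot (u i)) * (2 / w) ^ (k + 1))
            = (√(tot (u i)) * √(1 / tot (u i))) * (√(tot (v' i)) * √(1 / tot (v' i))) *
              (2 / w) ^ (k + 1) := by ring
          _ = _ := by rw [e1, e2]; ring
      · intro j hj
        have e3 : ((w ^ 8)⁻¹) ^ j = (2 / w) ^ j * ((2 * w ^ 7)⁻¹) ^ j := by
          rw [← mul_pow]
          congr 1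
          field_simp
        rw [e3, ← mul_assoc]
        have e4 : (2 / w) ^ j ≤ (2 / w) ^ (k + 1) :=
          pow_le_pow_of_le_one (by positivity) (by rw [div_le_one hw0]; exact hw) hj
        gcongr
      · intro x
        rw [le_div_iff₀ hv1]
        exact hux i x
      · intro y
        rw [le_div_iff₀ hu1]
        exact hvy i y
  rw [show f = fun z => ∑ i, AccS g (u i) (v' i) z from funext hsum]
  refine (Good.sum Finset.univ _ _ fun i _ => hgood i).mono (le_of_eq ?_)
  rw [Finset.sum_add_distrib, ← Finset.mul_sum, hlam]
  simp

end Core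

section Gadget

lemma sgn_decide_add (s t : ZMod 2) :
    sgn (decide (s + t = 1)) = sgn (decide (s = 1)) * sgn (decide (t = 1)) := by
  have h : ∀ s t : ZMod 2, decide (s + t = 1) = xor (decide (s = 1)) (decide (t = 1)) := by decide
  rw [h]
  cases decide (s = 1) <;> cases decide (t = 1) <;> simp [sgn]

lemma sgn_decide_sum {ι : Type*} (S : Finset ι) (t : ι → ZMod 2) :
    sgn (decide (∑ i ∈ S, t i = 1)) = ∏ i ∈ S, sgn (decide (t i = 1)) := by
  classical
  induction S using Finset.induction_on with
  | empty => simp [sgn]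
  | insert a S ha ih => rw [Finset.sum_insert ha, Finset.prod_insert ha, sgn_decide_add, ih]

/-- Local factor of the gadget. -/
def eloc (i : ℕ) (a c : Bool) : ℝ := sgn (a && c) * (if i = 0 then sgn a * sgn c else 1)

lemma sgn_gadget {b : ℕ} (hb : 0 < b) (x y : Fin b → Bool) :
    sgn (gadget x y) = ∏ i : Fin b, eloc i.val (x i) (y i) := by
  unfold gadget eloc
  rw [sgn_decide_add, sgn_decide_sum, dif_pos hb, sgn_decide_add, Finset.prod_mul_distrib]
  congr 1
  · refine Finset.prod_congr rfl fun i _ => ?_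
    cases x i <;> cases y i <;> simp
  · rw [Finset.prod_eq_single (⟨0, hb⟩ : Fin b)]
    · simp only [if_true]
      cases x ⟨0, hb⟩ <;> cases y ⟨0, hb⟩ <;> simp
    · intro i _ hi
      rw [if_neg]
      intro h
      exact hi (Fin.ext h)
    · simp

/-- Set bit number `k` to one. -/
def setBit {b : ℕ} (k : ℕ) (x : Fin b → Bool) : Fin b → Bool :=
  fun i => if i.val = k then true else x i

/-- The gadget with one bit fixed on either side. -/
def gad {b : ℕ} (x y : Fin b → Bool) : Bool := gadget (setBit 1 x) (setBit 2 y)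

/-- Local factor of the modified gadget. -/
def eloc2 (i : ℕ) (a c : Bool) : ℝ :=
  eloc i (if i = 1 then true else a) (if i = 2 then true else c)

lemma sgn_gad {b : ℕ} (hb : 0 < b) (x y : Fin b → Bool) :
    sgn (gad x y) = ∏ i : Fin b, eloc2 i.val (x i) (y i) := by
  unfold gad
  rw [sgn_gadget hb]
  rfl

lemma gad_bal_right {b : ℕ} (hb : 3 ≤ b) (x : Fin b → Bool) : ∑ y, sgn (gad x y) = 0 := by
  simp_rw [sgn_gad (by omega : 0 < b)]
  have := Fintype.prod_sum (fun (i : Fin b) (c : Bool) => eloc2 i.val (x i) c)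
  rw [← this]
  apply Finset.prod_eq_zero (Finset.mem_univ (⟨1, by omega⟩ : Fin b))
  simp [eloc2, eloc, sgn]

lemma gad_bal_left {b : ℕ} (hb : 3 ≤ b) (y : Fin b → Bool) : ∑ x, sgn (gad x y) = 0 := by
  simp_rw [sgn_gad (by omega : 0 < b)]
  have := Fintype.prod_sum (fun (i : Fin b) (c : Bool) => eloc2 i.val c (y i))
  rw [← this]
  apply Finset.prod_eq_zero (Finset.mem_univ (⟨2, by omega⟩ : Fin b))
  simp [eloc2, eloc, sgn]

lemma eloc2_disc (i : ℕ) (a : Bool) :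
    ∑ a' : Bool, |∑ c : Bool, eloc2 i a c * eloc2 i a' c| ≤
      2 * ((if i = 1 then 2 else 1) * (if i = 2 then 2 else 1)) := by
  by_cases h1 : i = 1
  · subst h1
    cases a <;> norm_num [eloc2, eloc, sgn]
  by_cases h2 : i = 2
  · subst h2
    cases a <;> norm_num [eloc2, eloc, sgn]
  by_cases h0 : i = 0
  · subst h0
    cases a <;> norm_num [eloc2, eloc, sgn]
  · cases a <;> norm_num [eloc2, eloc, sgn, h0, h1, h2]

lemma gad_disc {b : ℕ} (hb : 3 ≤ b) : DiscBound (gad (b := b)) (4 * 2 ^ b) := by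
  intro x
  simp_rw [sgn_gad (by omega : 0 < b), ← Finset.prod_mul_distrib]
  have h1 : ∀ x' : Fin b → Bool, |∑ y : Fin b → Bool,
      ∏ i : Fin b, eloc2 i.val (x i) (y i) * eloc2 i.val (x' i) (y i)| =
      ∏ i : Fin b, |∑ c, eloc2 i.val (x i) c * eloc2 i.val (x' i) c| := by
    intro x'
    have := Fintype.prod_sum (fun (i : Fin b) (c : Bool) =>
      eloc2 i.val (x i) c * eloc2 i.val (x' i) c)
    rw [← this, Finset.abs_prod]
  simp_rw [h1]
  have := Fintype.prod_sum (fun (i : Fin b) (a' : Bool) =>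
      |∑ c, eloc2 i.val (x i) c * eloc2 i.val a' c|)
  rw [← this]
  refine (Finset.prod_le_prod (fun i _ => Finset.sum_nonneg fun _ _ => abs_nonneg _)
    (fun i _ => eloc2_disc i.val (x i))).trans (le_of_eq ?_)
  rw [Finset.prod_mul_distrib, Finset.prod_mul_distrib]
  have e1 : ∀ k, k < b → ∏ i : Fin b, (if i.val = k then (2 : ℝ) else 1) = 2 := by
    intro k hk
    rw [Finset.prod_eq_single (⟨k, hk⟩ : Fin b)]
    · simp
    · intro i _ hi
      rw [if_neg]
      intro h
      exact hi (Fin.ext h)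
    · simp
  rw [e1 1 (by omega), e1 2 (by omega)]
  simp
  ring

end Gadget

lemma tailS_le (n k : ℕ) {w : ℝ} (hw : 2 ≤ w) (h : (1 + 1 / w) ^ n ≤ 2) :
    tailS n k (2 / w ^ 2) ≤ 2 * (2 / w) ^ (k + 1) := by
  have hw0 : 0 < w := by linarith
  unfold tailS
  calc ∑ S ∈ (Finset.univ : Finset (Finset (Fin n))).filter (fun S => k < S.card),
        (2 / w ^ 2) ^ S.card
      ≤ ∑ S ∈ (Finset.univ : Finset (Finset (Fin n))).filter (fun S => k < S.card),
        (2 / w) ^ (k + 1) * (1 / w) ^ S.card := by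
        refine Finset.sum_le_sum fun S hS => ?_
        have hk : k + 1 ≤ S.card := by
          simpa using (Finset.mem_filter.1 hS).2
        have e : (2 / w ^ 2) ^ S.card = (2 / w) ^ S.card * (1 / w) ^ S.card := by
          rw [← mul_pow]
          congr 1
          field_simp
        rw [e]
        have e4 : (2 / w) ^ S.card ≤ (2 / w) ^ (k + 1) :=
          pow_le_pow_of_le_one (by positivity) (by rw [div_le_one hw0]; exact hw) hk
        gcongr
    _ ≤ ∑ S : Finset (Fin n), (2 / w) ^ (k + 1) * (1 / w) ^ S.card :=
        Finset.sum_le_sum_of_subset_of_nonneg (Finset.subset_univ _)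
          (fun _ _ _ => by positivity)
    _ = (2 / w) ^ (k + 1) * (1 + 1 / w) ^ n := by rw [← Finset.mul_sum, sum_all_pow]
    _ ≤ (2 / w) ^ (k + 1) * 2 := by gcongr
    _ = _ := by ring

lemma nnRank_spec {α β : Type*} [Fintype α] [Fintype β] (M : α → β → ℝ)
    (hM : ∀ a b, 0 ≤ M a b) :
    ∃ (u : Fin (nnRank M) → α → ℝ) (v : Fin (nnRank M) → β → ℝ),
    (∀ i a, 0 ≤ u i a) ∧ (∀ i b, 0 ≤ v i b) ∧ ∀ a b, M a b = ∑ i, u i a * v i b := by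
  classical
  have hne : {r | ∃ (u : Fin r → α → ℝ) (v : Fin r → β → ℝ),
    (∀ i a, 0 ≤ u i a) ∧ (∀ i b, 0 ≤ v i b) ∧ ∀ a b, M a b = ∑ i, u i a * v i b}.Nonempty := by
    refine ⟨Fintype.card α, fun i a => if (Fintype.equivFin α).symm i = a then 1 else 0,
      fun i c => M ((Fintype.equivFin α).symm i) c, ?_, fun i c => hM _ _, ?_⟩
    · intro i a
      beta_reduce
      split_ifs <;> norm_num
    · intro a c
      rw [(Fintype.equivFin α).symm.sum_comp (fun a' => (if a' = a then 1 else 0) * M a' c)]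
      simp
  exact Nat.sInf_mem hne

lemma final_num {b d k r : ℕ} (hb : 100 ≤ b) (hd : 1 ≤ d) (hk : d ≤ 2 * (k + 1))
    (hr : (r : ℝ) ≤ (2 : ℝ) ^ ((b : ℝ) * d / 100)) :
    (4 + (r : ℝ)) * (2 / (2 : ℝ) ^ ((b : ℝ) / 8)) ^ (k + 1) ≤
      (2 : ℝ) ^ (-((b : ℝ) * (d : ℝ)) / 100) := by
  have hb' : (100 : ℝ) ≤ b := by exact_mod_cast hb
  have hd' : (1 : ℝ) ≤ d := by exact_mod_cast hd
  have hk' : (d : ℝ) ≤ 2 * ((k : ℝ) + 1) := by exact_mod_cast hk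
  have hbd : (100 : ℝ) ≤ b * d := by nlinarith
  have e1 : (2 / (2 : ℝ) ^ ((b : ℝ) / 8)) ^ (k + 1) ≤ (2 : ℝ) ^ (-((b : ℝ) * d / 20)) := by
    have : (2 / (2 : ℝ) ^ ((b : ℝ) / 8)) = (2 : ℝ) ^ (1 - (b : ℝ) / 8) := by
      rw [Real.rpow_sub (by norm_num), Real.rpow_one]
    rw [this, ← Real.rpow_natCast, ← Real.rpow_mul (by norm_num)]
    apply Real.rpow_le_rpow_of_exponent_le (by norm_num)
    push_cast
    nlinarith
  have e2 : 4 + (r : ℝ) ≤ (2 : ℝ) ^ (3 + (b : ℝ) * d / 100) := by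
    rw [Real.rpow_add (by norm_num)]
    have h1 : (1 : ℝ) ≤ (2 : ℝ) ^ ((b : ℝ) * d / 100) :=
      Real.one_le_rpow (by norm_num) (by positivity)
    have h2 : (2 : ℝ) ^ (3 : ℝ) = 8 := by
      rw [show (3 : ℝ) = ((3 : ℕ) : ℝ) by norm_num, Real.rpow_natCast]; norm_num
    rw [h2]
    linarith
  calc (4 + (r : ℝ)) * (2 / (2 : ℝ) ^ ((b : ℝ) / 8)) ^ (k + 1)
      ≤ (2 : ℝ) ^ (3 + (b : ℝ) * d / 100) * (2 : ℝ) ^ (-((b : ℝ) * d / 20)) := by gcongr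
    _ = (2 : ℝ) ^ (3 + (b : ℝ) * d / 100 + -((b : ℝ) * d / 20)) := by
        rw [← Real.rpow_add (by norm_num)]
    _ ≤ _ := by
        apply Real.rpow_le_rpow_of_exponent_le (by norm_num)
        linarith

lemma main_case {n b d : ℕ} (hn : 2 ≤ n) (hb : (100 : ℝ) * Real.logb 2 (n : ℝ) ≤ (b : ℝ))
    (f : (Fin n → Bool) → ℝ) (hf0 : ∀ x, 0 ≤ f x) (hf1 : uexp f = 1) (hd : 1 ≤ d)
    (hdr : 100 * Real.logb 2 ((nnRank (patternMatrix b f) : ℝ)) / (b : ℝ) ≤ (d : ℝ)) :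
    Good d f ((2 : ℝ) ^ (-((b : ℝ) * (d : ℝ)) / 100)) := by
  have hn' : (2 : ℝ) ≤ n := by exact_mod_cast hn
  have hlog : 1 ≤ Real.logb 2 (n : ℝ) := by
    rw [Real.le_logb_iff_rpow_le (by norm_num) (by linarith), Real.rpow_one]
    exact hn'
  have hb' : (100 : ℝ) ≤ b := by linarith
  have hb100 : 100 ≤ b := by exact_mod_cast hb'
  have hnb : (n : ℝ) ≤ (2 : ℝ) ^ ((b : ℝ) / 100) := by
    rw [← Real.logb_le_iff_le_rpow (by norm_num) (by linarith)]
    linarith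
  set w : ℝ := (2 : ℝ) ^ ((b : ℝ) / 8) with hw
  have hw8 : w ^ 8 = 2 ^ b := by
    rw [hw, ← Real.rpow_natCast, ← Real.rpow_mul (by norm_num), ← Real.rpow_natCast]
    congr 1
    push_cast
    ring
  have hw2 : 2 ≤ w := by
    calc (2 : ℝ) = 2 ^ (1 : ℝ) := (Real.rpow_one 2).symm
      _ ≤ w := Real.rpow_le_rpow_of_exponent_le (by norm_num) (by linarith)
  have hw0 : 0 < w := by linarith
  have hnw : (n : ℝ) * 2 ≤ w := by
    calc (n : ℝ) * 2 ≤ (2 : ℝ) ^ ((b : ℝ) / 100) * 2 ^ (1 : ℝ) := by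
          rw [Real.rpow_one]; linarith
      _ = (2 : ℝ) ^ ((b : ℝ) / 100 + 1) := by rw [Real.rpow_add (by norm_num)]
      _ ≤ w := Real.rpow_le_rpow_of_exponent_le (by norm_num) (by linarith)
  have h1w : (1 + 1 / w) ^ n ≤ 2 := by
    have h1 : 1 + 1 / w ≤ Real.exp (1 / w) := by
      have := Real.add_one_le_exp (1 / w)
      linarith
    calc (1 + 1 / w) ^ n ≤ (Real.exp (1 / w)) ^ n := by gcongr
      _ = Real.exp (n * (1 / w)) := by rw [← Real.exp_nat_mul]
      _ ≤ Real.exp (Real.log 2) := by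
          apply Real.exp_le_exp.2
          have h2 := Real.log_two_gt_d9
          have : (n : ℝ) * (1 / w) ≤ 1 / 2 := by
            rw [mul_one_div, div_le_div_iff₀ hw0 (by norm_num)]
            linarith
          linarith
      _ = 2 := Real.exp_log (by norm_num)
  have hε : (1 + 2 / w ^ 2) ^ n ≤ 2 := by
    refine le_trans ?_ h1w
    have : 2 / w ^ 2 ≤ 1 / w := by
      rw [div_le_div_iff₀ (by positivity) hw0]
      nlinarith
    gcongr
  have hr : (nnRank (patternMatrix b f) : ℝ) ≤ (2 : ℝ) ^ ((b : ℝ) * d / 100) := by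
    rcases Nat.eq_zero_or_pos (nnRank (patternMatrix b f)) with h0 | h0
    · rw [h0]
      push_cast
      positivity
    · rw [← Real.logb_le_iff_le_rpow (by norm_num) (by exact_mod_cast h0)]
      rw [div_le_iff₀ (by linarith)] at hdr
      linarith
  obtain ⟨u, v, hu, hv, huv⟩ := nnRank_spec (patternMatrix b f) (fun _ _ => hf0 _)
  have hcore := core (X := Fin b → Bool) (n := n) (gad (b := b)) hw2
    (by rw [hw8]; exact gad_disc (by omega)) (by rw [hw8]; simp)
    (gad_bal_right (by omega)) (gad_bal_left (by omega)) (k := d / 2) (d := d) (by omega) hε f hf1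
    (fun i x => u i (fun j => setBit 1 (x j))) (fun i y => v i (fun j => setBit 2 (y j)))
    (fun _ _ => hu _ _) (fun _ _ => hv _ _) (fun x y => huv _ _)
  refine hcore.mono ?_
  have h3 := tailS_le n (d / 2) hw2 h1w
  refine le_trans ?_ (final_num (k := d / 2) hb100 hd (by omega) hr)
  rw [← hw]
  linarith

/-- small nonnegative rank of the pattern matrix implies that `f`
is an approximate conical junta. -/
theorem stmt3 :
    ∃ α₁ : ℝ, 1 ≤ α₁ ∧
      ∀ (n : ℕ), 1 ≤ n →
      ∀ b : ℕ, α₁ * Real.logb 2 (n : ℝ) ≤ (b : ℝ) →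
      ∀ f : (Fin n → Bool) → ℝ, (∀ x, 0 ≤ f x) → uexp f = 1 →
      ∀ d : ℕ, α₁ * Real.logb 2 ((nnRank (patternMatrix b f) : ℝ)) / (b : ℝ) ≤ (d : ℝ) →
      IsApproxConicalJunta ((2 : ℝ) ^ (-(b : ℝ) / 2))
        ((2 : ℝ) ^ (-((b : ℝ) * (d : ℝ)) / α₁)) d f := by
  refine ⟨100, by norm_num, ?_⟩
  intro n hn b hb f hf0 hf1 d hd
  refine Good.approx (by positivity) ?_ hf1
  rcases Nat.eq_zero_or_pos d with h0 | h0
  · refine (Good.error hf0).mono ?_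
    rw [hf1, h0]
    simp
  rcases le_or_gt n d with h1 | h1
  · refine ⟨f, fun _ => 0, ?_, fun _ => le_rfl, ?_, fun z => by simp⟩
    · refine InCone.of_junta Finset.univ (by simpa using h1) f hf0 ?_
      intro z z' h
      rw [funext fun i => h i (Finset.mem_univ i)]
    · have : uexp (fun _ : Fin n → Bool => (0 : ℝ)) = 0 := by simp [uexp]
      rw [this]
      positivity
  · exact main_case (by omega) hb f hf0 hf1 h0 hd
end
end

section
/- Let f : {-1,1}^n → ℝ≥0 satisfy E[f] ≤ 1, and suppose f is an (ε,δ)-approximate conical d-junta where ε < 1/n⁴, d ≥ deg(f) (the Fourier degree of f), and δ < 1/n^{8d}. Then deg₊(f + 1/n) ≤ 8d, i.e., the function x ↦ f(x) + 1/n is a conical 8d-junta. -/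
open scoped BigOperators

noncomputable section

namespace S4

lemma sgn_mul_self (b : Bool) : sgn b * sgn b = 1 := by
  cases b <;> simp [sgn]

lemma abs_sgn (b : Bool) : |sgn b| = 1 := by
  cases b <;> simp [sgn]

variable {n : ℕ}

lemma abs_chi (S : Finset (Fin n)) (x : Fin n → Bool) : |chi S x| = 1 := by
  unfold chi
  rw [Finset.abs_prod]
  simp [abs_sgn]

lemma chi_empty (x : Fin n → Bool) : chi ∅ x = 1 := by simp [chi]

lemma uexp_sum {ι Ω : Type*} [Fintype Ω] (s : Finset ι) (F : ι → Ω → ℝ) :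
    uexp (fun x => ∑ i ∈ s, F i x) = ∑ i ∈ s, uexp (F i) := by
  unfold uexp
  rw [Finset.sum_comm, Finset.sum_div]

lemma uexp_add {Ω : Type*} [Fintype Ω] (F G : Ω → ℝ) :
    uexp (fun x => F x + G x) = uexp F + uexp G := by
  unfold uexp
  rw [Finset.sum_add_distrib, add_div]

lemma uexp_mul {Ω : Type*} [Fintype Ω] (c : ℝ) (F : Ω → ℝ) :
    uexp (fun x => c * F x) = c * uexp F := by
  unfold uexp
  rw [← Finset.mul_sum, mul_div_assoc]

lemma abs_uexp_le {Ω : Type*} [Fintype Ω] (F G : Ω → ℝ) (h : ∀ x, |F x| ≤ G x) :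
    |uexp F| ≤ uexp G := by
  unfold uexp
  rw [abs_div, abs_of_nonneg (by positivity : (0:ℝ) ≤ (Fintype.card Ω : ℝ))]
  gcongr
  exact (Finset.abs_sum_le_sum_abs _ _).trans (Finset.sum_le_sum fun x _ => h x)

lemma chi_mul_sum (x y : Fin n → Bool) :
    ∑ S : Finset (Fin n), chi S x * chi S y = if x = y then (2:ℝ) ^ n else 0 := by
  have h := Finset.prod_one_add (f := fun i : Fin n => sgn (x i) * sgn (y i)) Finset.univ
  rw [Finset.powerset_univ] at h
  have h2 : ∑ S : Finset (Fin n), chi S x * chi S y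
      = ∏ i : Fin n, (1 + sgn (x i) * sgn (y i)) := by
    rw [h]
    refine Finset.sum_congr rfl fun S _ => ?_
    rw [Finset.prod_mul_distrib]; rfl
  rw [h2]
  split_ifs with hxy
  · subst hxy
    simp only [sgn_mul_self]
    norm_num
  · obtain ⟨i, hi⟩ := Function.ne_iff.mp hxy
    apply Finset.prod_eq_zero (Finset.mem_univ i)
    cases hx : x i <;> cases hy : y i <;> simp_all [sgn]

lemma inversion (f : (Fin n → Bool) → ℝ) (x : Fin n → Bool) :
    f x = ∑ S : Finset (Fin n), fCoeff f S * chi S x := by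
  unfold fCoeff uexp
  have : ∀ S : Finset (Fin n), (∑ y, f y * chi S y) / (Fintype.card (Fin n → Bool) : ℝ) * chi S x
      = ∑ y, f y / (Fintype.card (Fin n → Bool) : ℝ) * (chi S y * chi S x) := by
    intro S
    rw [Finset.sum_div, Finset.sum_mul]
    refine Finset.sum_congr rfl fun y _ => ?_
    ring
  simp only [this]
  rw [Finset.sum_comm]
  simp only [← Finset.mul_sum, chi_mul_sum]
  simp

/-- flipping coordinate `i`. -/
lemma coeff_junta (F : (Fin n → Bool) → ℝ) (T S : Finset (Fin n))
    (hF : ∀ x y, (∀ i ∈ T, x i = y i) → F x = F y) (hS : ¬ S ⊆ T) : fCoeff F S = 0 := by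
  obtain ⟨i, hiS, hiT⟩ := Finset.not_subset.mp hS
  have hinv : Function.Involutive
      (fun x : Fin n → Bool => Function.update x i (!(x i))) := by
    intro x
    simp
  let φ : Equiv.Perm (Fin n → Bool) := hinv.toPerm
  have hφ : ∀ x, φ x = Function.update x i (!(x i)) := fun _ => rfl
  have key : ∑ x, F x * chi S x = ∑ x, -(F x * chi S x) := by
    rw [← Equiv.sum_comp φ]
    refine Finset.sum_congr rfl fun x _ => ?_
    have h1 : F (φ x) = F x := by
      apply hF
      intro j hj
      have : j ≠ i := by rintro rfl; exact hiT hj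
      simp [hφ, this]
    have h2 : chi S (φ x) = - chi S x := by
      unfold chi
      rw [← Finset.mul_prod_erase _ _ hiS, ← Finset.mul_prod_erase _ _ hiS]
      have h3 : ∏ j ∈ S.erase i, sgn (φ x j) = ∏ j ∈ S.erase i, sgn (x j) := by
        refine Finset.prod_congr rfl fun j hj => ?_
        have : j ≠ i := Finset.ne_of_mem_erase hj
        simp [hφ, this]
      rw [h3]
      have h4 : sgn (φ x i) = - sgn (x i) := by
        cases hx : x i <;> simp [hφ, sgn, hx]
      rw [h4]; ring
    rw [h1, h2]; ring
  rw [Finset.sum_neg_distrib] at key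
  unfold fCoeff uexp
  have : ∑ x, F x * chi S x = 0 := by linarith
  rw [this]; simp

lemma coeff_of_fdeg (f : (Fin n → Bool) → ℝ) (d : ℕ) (hd : fdeg f ≤ d)
    (S : Finset (Fin n)) (hS : d < S.card) : fCoeff f S = 0 := by
  classical
  by_contra h
  have : S.card ≤ fdeg f := by
    unfold fdeg
    exact Finset.le_sup (f := Finset.card) (by simpa using h)
  omega

lemma cj_sum {ι : Type*} [Fintype ι] (d : ℕ) (c : ι → ℝ) (g : ι → (Fin n → Bool) → ℝ)
    (hc : ∀ i, 0 ≤ c i) (hg : ∀ i x, 0 ≤ g i x) (hj : ∀ i, IsJunta d (g i))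
    (f : (Fin n → Bool) → ℝ) (hf : ∀ x, f x = ∑ i, c i * g i x) : IsConicalJunta d f := by
  refine ⟨Fintype.card ι, fun k => c ((Fintype.equivFin ι).symm k),
    fun k => g ((Fintype.equivFin ι).symm k), fun k => hc _, fun k => hg _, fun k => hj _, ?_⟩
  intro x
  rw [hf x]
  exact (Equiv.sum_comp (Fintype.equivFin ι).symm (fun i => c i * g i x)).symm

lemma cj_mono {d e : ℕ} (h : d ≤ e) {f : (Fin n → Bool) → ℝ} (hf : IsConicalJunta d f) :
    IsConicalJunta e f := by
  obtain ⟨N, c, g, hc, hg, hj, h1⟩ := hf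
  refine ⟨N, c, g, hc, hg, fun i => ?_, h1⟩
  obtain ⟨T, hT, h2⟩ := hj i
  exact ⟨T, hT.trans h, h2⟩

lemma cj_of_junta {d : ℕ} {f : (Fin n → Bool) → ℝ} (h0 : ∀ x, 0 ≤ f x) (hf : IsJunta d f) :
    IsConicalJunta d f :=
  cj_sum (ι := Unit) d (fun _ => 1) (fun _ => f) (by simp) (fun _ => h0) (fun _ => hf) f (by simp)

lemma cj_lincomb {ι : Type*} [Fintype ι] (d : ℕ) (c : ι → ℝ) (F : ι → (Fin n → Bool) → ℝ)
    (hc : ∀ i, 0 ≤ c i) (hF : ∀ i, IsConicalJunta d (F i)) :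
    IsConicalJunta d (fun x => ∑ i, c i * F i x) := by
  choose N a g ha hg hj h1 using hF
  refine cj_sum (ι := Σ i, Fin (N i)) d (fun p => c p.1 * a p.1 p.2) (fun p => g p.1 p.2)
    (fun p => mul_nonneg (hc _) (ha _ _)) (fun p => hg _ _) (fun p => hj _ _) _ ?_
  intro x
  rw [Fintype.sum_sigma]
  refine Finset.sum_congr rfl fun i _ => ?_
  rw [h1, Finset.mul_sum]
  refine Finset.sum_congr rfl fun j _ => ?_
  ring

lemma cj_add {d : ℕ} {F G : (Fin n → Bool) → ℝ} (hF : IsConicalJunta d F)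
    (hG : IsConicalJunta d G) : IsConicalJunta d (fun x => F x + G x) := by
  have := cj_lincomb (ι := Bool) d (fun _ => 1) (fun b => if b then F else G) (by simp)
    (by intro b; cases b <;> simpa)
  simpa using this

lemma cj_core (a b : ℕ) (C : (Fin n → Bool) → ℝ) (I : Finset (Fin n)) (hI : I.card ≤ a)
    (hC0 : ∀ x, 0 ≤ C x) (hC : ∀ x y, (∀ i ∈ I, x i = y i) → C x = C y)
    (V : Finset (Finset (Fin n))) (hV : ∀ S ∈ V, S.card ≤ b) (c : Finset (Fin n) → ℝ) (r : ℝ)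
    (hr : ∑ S ∈ V, |c S| ≤ r) :
    IsConicalJunta (a + b) (fun x => C x * (r + ∑ S ∈ V, c S * chi S x)) := by
  have h1 : IsConicalJunta (a + b) (fun x => C x * (r - ∑ S ∈ V, |c S|)) := by
    apply cj_of_junta
    · intro x; exact mul_nonneg (hC0 x) (by linarith)
    · exact ⟨I, by omega, fun x y h => by simp only [hC x y h]⟩
  have h2 : IsConicalJunta (a + b)
      (fun x => ∑ S : V, (1:ℝ) * (C x * (|c S| + c S * chi S.1 x))) := by
    apply cj_lincomb (ι := V) (a + b) (fun _ => 1)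
      (fun S x => C x * (|c S| + c S * chi S.1 x)) (by simp)
    intro S
    apply cj_of_junta
    · intro x
      apply mul_nonneg (hC0 x)
      have : |c S * chi S.1 x| = |c S| := by rw [abs_mul, abs_chi, mul_one]
      have := neg_abs_le (c S * chi S.1 x)
      linarith
    · refine ⟨I ∪ S.1, (Finset.card_union_le _ _).trans ?_, ?_⟩
      · have := hV S.1 S.2; omega
      · intro x y h
        have e1 : C x = C y := hC x y fun i hi => h i (Finset.mem_union_left _ hi)
        have e2 : chi S.1 x = chi S.1 y := by
          unfold chi
          exact Finset.prod_congr rfl fun i hi => by rw [h i (Finset.mem_union_right _ hi)]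
        simp only [e1, e2]
  have h3 := cj_add h1 h2
  convert h3 using 2 with x
  simp only [one_mul]
  rw [Finset.sum_coe_sort V (fun S => C x * (|c S| + c S * chi S x)), ← Finset.mul_sum,
    Finset.sum_add_distrib]
  ring

lemma sum_inv_pow (hn : 1 ≤ n) : ∑ S : Finset (Fin n), (1 / (n:ℝ)) ^ S.card ≤ 3 := by
  have h := Finset.prod_one_add (f := fun _ : Fin n => 1 / (n:ℝ)) Finset.univ
  rw [Finset.powerset_univ] at h
  simp only [Finset.prod_const, Finset.card_univ, Fintype.card_fin] at h
  rw [← h]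
  have hn0 : (n:ℝ) ≠ 0 := by positivity
  calc (1 + 1 / (n:ℝ)) ^ n ≤ (Real.exp (1 / n)) ^ n := by
        gcongr
        have := Real.add_one_le_exp (1 / (n:ℝ)); linarith
    _ = Real.exp 1 := by rw [← Real.exp_nat_mul]; congr 1; field_simp
    _ ≤ 3 := by have := Real.exp_one_lt_d9; linarith

lemma count_le (hn : 1 ≤ n) (m : ℕ) (V : Finset (Finset (Fin n))) (hV : ∀ S ∈ V, S.card ≤ m) :
    (V.card : ℝ) ≤ 3 * (n:ℝ) ^ m := by
  have hn1 : (1:ℝ) ≤ n := by exact_mod_cast hn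
  have hn0 : (0:ℝ) < n := by linarith
  calc (V.card : ℝ) = ∑ S ∈ V, (1:ℝ) := by simp
    _ ≤ ∑ S ∈ V, (n:ℝ) ^ m * (1 / (n:ℝ)) ^ S.card := by
        refine Finset.sum_le_sum fun S hS => ?_
        rw [one_div, inv_pow, ← div_eq_mul_inv, one_le_div (by positivity)]
        exact pow_le_pow_right₀ hn1 (hV S hS)
    _ ≤ ∑ S : Finset (Fin n), (n:ℝ) ^ m * (1 / (n:ℝ)) ^ S.card :=
        Finset.sum_le_sum_of_subset_of_nonneg (Finset.subset_univ _) fun _ _ _ => by positivity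
    _ ≤ 3 * (n:ℝ) ^ m := by
        rw [← Finset.mul_sum, mul_comm]
        gcongr
        exact sum_inv_pow hn

lemma decay_tail (hn : 1 ≤ n) (ε : ℝ) (hε : ε < 1 / (n:ℝ) ^ 4) (h : (Fin n → Bool) → ℝ)
    (hh : IsDecaying ε h) (k : ℕ) (V : Finset (Finset (Fin n))) (hV : ∀ S ∈ V, k ≤ S.card) :
    ∑ S ∈ V, |fCoeff h S| ≤ 3 * (1 / (n:ℝ)) ^ (3 * k) := by
  have hn1 : (1:ℝ) ≤ n := by exact_mod_cast hn
  have hn0 : (0:ℝ) < n := by linarith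
  have hε0 : 0 ≤ ε := by
    have := hh.2 {⟨0, hn⟩}
    simp only [Finset.card_singleton, pow_one] at this
    exact (abs_nonneg _).trans this
  have hi1 : 1 / (n:ℝ) ≤ 1 := by rw [div_le_one hn0]; exact hn1
  calc ∑ S ∈ V, |fCoeff h S| ≤ ∑ S ∈ V, (1 / (n:ℝ)) ^ (3 * k) * (1 / (n:ℝ)) ^ S.card := by
        refine Finset.sum_le_sum fun S hS => ?_
        calc |fCoeff h S| ≤ ε ^ S.card := hh.2 S
          _ ≤ (1 / (n:ℝ) ^ 4) ^ S.card := by gcongr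
          _ = (1 / (n:ℝ)) ^ (3 * S.card) * (1 / (n:ℝ)) ^ S.card := by
              rw [← pow_add, ← one_div_pow, ← pow_mul]; congr 1; ring
          _ ≤ _ := by
              apply mul_le_mul_of_nonneg_right _ (by positivity)
              apply pow_le_pow_of_le_one (by positivity) hi1
              have := hV S hS; omega
    _ ≤ ∑ S : Finset (Fin n), (1 / (n:ℝ)) ^ (3 * k) * (1 / (n:ℝ)) ^ S.card :=
        Finset.sum_le_sum_of_subset_of_nonneg (Finset.subset_univ _) fun _ _ _ => by positivity
    _ ≤ 3 * (1 / (n:ℝ)) ^ (3 * k) := by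
        rw [← Finset.mul_sum, mul_comm]
        gcongr
        exact sum_inv_pow hn

lemma conj_props {d : ℕ} {C : (Fin n → Bool) → ℝ} (h : IsConjunction d C) :
    ∃ I : Finset (Fin n), I.card ≤ d ∧ (∀ x, 0 ≤ C x) ∧
      (∀ x y, (∀ i ∈ I, x i = y i) → C x = C y) ∧ uexp C = 1 := by
  classical
  obtain ⟨I, a, hI, hC⟩ := h
  refine ⟨I, hI, ?_, ?_, ?_⟩
  · intro x; rw [hC]; positivity
  · intro x y hxy
    rw [hC, hC]
    congr 2
    apply propext
    refine forall_congr' fun i => forall_congr' fun hi => ?_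
    rw [hxy i hi]
  · have h1 : ∀ x, C x = ∏ i : Fin n, (if i ∈ I then (if x i = a i then (2:ℝ) else 0) else 1) := by
      intro x
      rw [hC, Finset.prod_ite_mem, Finset.univ_inter]
      split_ifs with hx
      · rw [Finset.prod_congr rfl (fun i hi => if_pos (hx i hi))]; simp
      · push Not at hx
        obtain ⟨i, hi, hne⟩ := hx
        rw [Finset.prod_eq_zero hi (if_neg hne)]; simp
    unfold uexp
    simp only [h1]
    have h2 := Fintype.prod_sum
      (fun (i : Fin n) (b : Bool) => if i ∈ I then (if b = a i then (2:ℝ) else 0) else 1)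
    rw [← h2]
    have h3 : ∀ i : Fin n,
        ∑ b : Bool, (if i ∈ I then (if b = a i then (2:ℝ) else 0) else 1) = 2 := by
      intro i
      split_ifs with hi
      · simp
      · simp
    simp [h3]

lemma coeff_bound_conj {C : (Fin n → Bool) → ℝ} (h0 : ∀ x, 0 ≤ C x) (h1 : uexp C = 1)
    (V : Finset (Finset (Fin n))) (c : Finset (Fin n) → ℝ) (S : Finset (Fin n)) :
    |fCoeff (fun x => C x * ∑ T ∈ V, c T * chi T x) S| ≤ ∑ T ∈ V, |c T| := by
  unfold fCoeff
  have := abs_uexp_le (fun x => (C x * ∑ T ∈ V, c T * chi T x) * chi S x)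
    (fun x => (∑ T ∈ V, |c T|) * C x) (by
      intro x
      rw [abs_mul, abs_chi, mul_one, abs_mul, abs_of_nonneg (h0 x), mul_comm]
      apply mul_le_mul_of_nonneg_right _ (h0 x)
      refine (Finset.abs_sum_le_sum_abs _ _).trans (Finset.sum_le_sum fun T _ => ?_)
      rw [abs_mul, abs_chi, mul_one])
  rwa [uexp_mul, h1, mul_one] at this

lemma fCoeff_add (F G : (Fin n → Bool) → ℝ) (S : Finset (Fin n)) :
    fCoeff (fun x => F x + G x) S = fCoeff F S + fCoeff G S := by
  unfold fCoeff
  rw [← uexp_add]; congr 1; funext x; ring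

lemma fCoeff_lincomb {ι : Type*} (s : Finset ι) (c : ι → ℝ) (F : ι → (Fin n → Bool) → ℝ)
    (S : Finset (Fin n)) :
    fCoeff (fun x => ∑ i ∈ s, c i * F i x) S = ∑ i ∈ s, c i * fCoeff (F i) S := by
  unfold fCoeff
  simp only [← uexp_mul]
  rw [← uexp_sum]; congr 1; funext x
  rw [Finset.sum_mul]
  exact Finset.sum_congr rfl fun i _ => by ring

end S4

open S4

/-- approximate conical juntas to exact conical juntas. -/
theorem stmt4 (n : ℕ) (hn : 1 ≤ n) (f : (Fin n → Bool) → ℝ)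
    (hf0 : ∀ x, 0 ≤ f x) (hf1 : uexp f ≤ 1)
    (ε δ : ℝ) (d : ℕ)
    (happrox : IsApproxConicalJunta ε δ d f)
    (hε : ε < 1 / (n : ℝ) ^ 4) (hd : fdeg f ≤ d) (hδ : δ < 1 / (n : ℝ) ^ (8 * d)) :
    IsConicalJunta (8 * d) (fun x => f x + 1 / (n : ℝ)) := by
  classical
  have hn1 : (1:ℝ) ≤ n := by exact_mod_cast hn
  have hn0 : (0:ℝ) < n := by linarith
  have hnn : ∀ x, 0 ≤ f x + 1 / (n:ℝ) := fun x => add_nonneg (hf0 x) (by positivity)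
  rcases Nat.eq_zero_or_pos d with rfl | hdpos
  · apply cj_of_junta hnn
    refine ⟨∅, by simp, fun x y _ => ?_⟩
    have key : ∀ z, f z = fCoeff f ∅ := by
      intro z
      rw [inversion f z, Finset.sum_eq_single ∅]
      · simp [chi_empty]
      · intro S _ hS
        rw [coeff_of_fdeg f 0 hd S (Finset.card_pos.mpr (Finset.nonempty_iff_ne_empty.mpr hS)),
          zero_mul]
      · simp
    simp only [key]
  by_cases hbig : n ≤ 8 * d
  · apply cj_of_junta hnn
    refine ⟨Finset.univ, by simpa using hbig, fun x y h => ?_⟩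
    have : x = y := funext fun i => h i (Finset.mem_univ i)
    rw [this]
  have hn9 : (9:ℝ) ≤ n := by
    have : 9 ≤ n := by omega
    exact_mod_cast this
  obtain ⟨N, lam, C, h, γ, hlam, hlam1, hC, hh, hγ, hγδ, hfeq⟩ := happrox
  choose I hI hC0 hCI hC1 using fun i => conj_props (hC i)
  set t : ℝ := 1 / (n:ℝ) with ht
  have ht0 : 0 < t := by positivity
  have ht9 : t ≤ 1 / 9 := one_div_le_one_div_of_le (by norm_num) hn9
  set Lo : Finset (Finset (Fin n)) :=
    Finset.univ.filter (fun S => 1 ≤ S.card ∧ S.card ≤ d) with hLo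
  set Hi : Finset (Finset (Fin n)) := Finset.univ.filter (fun S => d + 1 ≤ S.card) with hHi
  have hsplit : ∀ i x, 1 + h i x = (1 + ∑ S ∈ Lo, fCoeff (h i) S * chi S x)
      + ∑ S ∈ Hi, fCoeff (h i) S * chi S x := by
    intro i x
    have hdisj : Disjoint Lo Hi := by
      rw [Finset.disjoint_left]
      intro S h1 h2
      simp only [hLo, hHi, Finset.mem_filter, Finset.mem_univ, true_and] at h1 h2
      omega
    rw [add_assoc, ← Finset.sum_union hdisj]
    congr 1
    rw [inversion (h i) x]
    symm
    apply Finset.sum_subset (Finset.subset_univ _)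
    intro S _ hS
    have : S = ∅ := by
      simp only [hLo, hHi, Finset.mem_union, Finset.mem_filter, Finset.mem_univ, true_and] at hS
      rw [← Finset.card_eq_zero]; omega
    subst this
    have h0 : fCoeff (h i) ∅ = 0 := by
      rw [← (hh i).1]; unfold fCoeff; simp [chi_empty]
    rw [h0, zero_mul]
  have hLoJ : ∀ i, IsConicalJunta (d + d)
      (fun x => C i x * (1 + ∑ S ∈ Lo, fCoeff (h i) S * chi S x)) := by
    intro i
    apply cj_core d d (C i) (I i) (hI i) (hC0 i) (hCI i) Lo
    · intro S hS
      simp only [hLo, Finset.mem_filter] at hS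
      exact hS.2.2
    · refine (decay_tail hn ε hε (h i) (hh i) 1 Lo ?_).trans ?_
      · intro S hS
        simp only [hLo, Finset.mem_filter] at hS
        exact hS.2.1
      · have : t ^ (3 * 1) ≤ (1 / 9) ^ (3 * 1) := by gcongr
        have e : ((1:ℝ) / 9) ^ (3 * 1) = 1 / 729 := by norm_num
        rw [e] at this
        linarith
  set P : (Fin n → Bool) → ℝ :=
    fun x => ∑ i, lam i * (C i x * (1 + ∑ S ∈ Lo, fCoeff (h i) S * chi S x)) with hP
  have hPJ : IsConicalJunta (d + d) P := cj_lincomb (d + d) lam _ hlam hLoJ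
  set G : (Fin n → Bool) → ℝ :=
    fun x => (∑ i, lam i * (C i x * ∑ S ∈ Hi, fCoeff (h i) S * chi S x)) + γ x with hG
  have hfPG : ∀ x, f x = P x + G x := by
    intro x
    rw [hfeq x, hP, hG]
    simp only
    rw [← add_assoc, ← Finset.sum_add_distrib]
    congr 1
    refine Finset.sum_congr rfl fun i _ => ?_
    rw [hsplit i x]; ring
  have hGb : ∀ S, |fCoeff G S| ≤ 3 * t ^ (3 * (d + 1)) + t ^ (8 * d) := by
    intro S
    rw [hG, fCoeff_add, fCoeff_lincomb]
    refine (abs_add_le _ _).trans (add_le_add ?_ ?_)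
    · refine (Finset.abs_sum_le_sum_abs _ _).trans ?_
      calc ∑ i, |lam i * fCoeff (fun x => C i x * ∑ S ∈ Hi, fCoeff (h i) S * chi S x) S|
          ≤ ∑ i, lam i * (3 * t ^ (3 * (d + 1))) := by
            refine Finset.sum_le_sum fun i _ => ?_
            rw [abs_mul, abs_of_nonneg (hlam i)]
            apply mul_le_mul_of_nonneg_left _ (hlam i)
            refine (coeff_bound_conj (hC0 i) (hC1 i) Hi _ S).trans ?_
            apply decay_tail hn ε hε (h i) (hh i) (d + 1) Hi
            intro S hS
            simp only [hHi, Finset.mem_filter] at hS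
            exact hS.2
        _ ≤ 1 * (3 * t ^ (3 * (d + 1))) := by
            rw [← Finset.sum_mul]
            gcongr
        _ = _ := one_mul _
    · have h1 : |fCoeff γ S| ≤ uexp γ := by
        apply abs_uexp_le
        intro x
        rw [abs_mul, abs_chi, mul_one, abs_of_nonneg (hγ x)]
      rw [ht, one_div_pow]
      linarith
  have hGz : ∀ S : Finset (Fin n), d + d < S.card → fCoeff G S = 0 := by
    intro S hS
    have h1 : fCoeff f S = 0 := coeff_of_fdeg f d hd S (by omega)
    have h2 : fCoeff P S = 0 := by
      obtain ⟨M, c, g, hc, hg, hj, he⟩ := hPJ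
      have : P = fun x => ∑ i, c i * g i x := funext he
      rw [this, fCoeff_lincomb]
      apply Finset.sum_eq_zero
      intro i _
      obtain ⟨T, hT, hTg⟩ := hj i
      rw [coeff_junta (g i) T S hTg, mul_zero]
      intro hsub
      have := Finset.card_le_card hsub
      omega
    have h3 : fCoeff f S = fCoeff P S + fCoeff G S := by
      rw [← fCoeff_add]; congr 1; funext x; exact hfPG x
    linarith
  set W : Finset (Finset (Fin n)) := Finset.univ.filter (fun S => S.card ≤ d + d) with hW
  have hWm : ∀ S ∈ W, S.card ≤ d + d := by
    intro S hS
    simp only [hW, Finset.mem_filter] at hS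
    exact hS.2
  have hGsum : ∑ S ∈ W, |fCoeff G S| ≤ t := by
    have hcount := count_le hn (d + d) W hWm
    have hnt : (n:ℝ) * t = 1 := by rw [ht]; field_simp
    have hnt2 : (n:ℝ) ^ (d + d) * t ^ (d + d) = 1 := by rw [← mul_pow, hnt, one_pow]
    have ht1 : t ≤ 1 := by linarith
    calc ∑ S ∈ W, |fCoeff G S| ≤ ∑ S ∈ W, (3 * t ^ (3 * (d + 1)) + t ^ (8 * d)) :=
          Finset.sum_le_sum fun S _ => hGb S
      _ = W.card * (3 * t ^ (3 * (d + 1)) + t ^ (8 * d)) := by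
          rw [Finset.sum_const, nsmul_eq_mul]
      _ ≤ (3 * (n:ℝ) ^ (d + d)) * (4 * (t ^ (d + d) * t ^ 3)) := by
          apply mul_le_mul hcount _ (by positivity) (by positivity)
          have e1 : t ^ (3 * (d + 1)) ≤ t ^ (d + d + 3) :=
            pow_le_pow_of_le_one ht0.le ht1 (by omega)
          have e2 : t ^ (8 * d) ≤ t ^ (d + d + 3) :=
            pow_le_pow_of_le_one ht0.le ht1 (by omega)
          rw [pow_add _ (d + d) 3] at e1 e2
          linarith
      _ = 12 * t ^ 3 * ((n:ℝ) ^ (d + d) * t ^ (d + d)) := by ring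
      _ = 12 * t ^ 3 := by rw [hnt2, mul_one]
      _ ≤ t := by
          have : t * t ≤ 1 / 9 * (1 / 9) := by gcongr
          nlinarith
  have hGJ := cj_core (n := n) 0 (d + d) (fun _ => 1) ∅ (by simp) (by simp) (by simp) W hWm
    (fCoeff G) t hGsum
  rw [zero_add] at hGJ
  have hfin := cj_add hPJ hGJ
  have hfin2 := cj_mono (show d + d ≤ 8 * d by omega) hfin
  convert hfin2 using 2 with x
  rw [hfPG x]
  have : G x = ∑ S ∈ W, fCoeff G S * chi S x := by
    conv_lhs => rw [inversion G x]
    symm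
    apply Finset.sum_subset (Finset.subset_univ _)
    intro S _ hS
    simp only [hW, Finset.mem_filter, Finset.mem_univ, true_and, not_le] at hS
    rw [hGz S hS, zero_mul]
  rw [← this]; ring
end
end
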